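/- arXiv:1102.2039 — 3 statements merged into one kernel-verified Lean document; each statement's English description precedes it below -/
import Mathlib

section
/- For every finite arrangement A of affine hyperplanes in ℝ^ℓ there exist affine-linear forms h_1, …, h_ℓ on ℝ^ℓ defining a flag F (where F^q = {h_{q+1} = ⋯ = h_ℓ = 0} for 0 ≤ q ≤ ℓ, so dim F^q = q) such that F is generic for A and satisfies both: (1) for every chamber C and every q, if C ∩ F^q ≠ ∅ and C ∩ F^{q−1} = ∅ (with F^{−1} = ∅), then h_q > 0 on C ∩ F^q; and (2) for any two distinct X, X' ∈ L(A) of dimension ℓ − q, h_q takes different values at the unique point of X ∩ F^q and the unique point of X' ∩ F^q. -/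
open Set

namespace IY

/-- An affine hyperplane arrangement in `ℝ^ℓ`, given by `n` affine-linear forms
with nonzero linear parts; the `i`-th hyperplane is the zero set of `α i`. -/
structure Arrangement (ℓ n : ℕ) where
  α : Fin n → ((Fin ℓ → ℝ) →ᵃ[ℝ] ℝ)
  nonzero : ∀ i, (α i).linear ≠ 0

namespace Arrangement

variable {ℓ n : ℕ} (A : Arrangement ℓ n)

/-- The hyperplane `H_i = {α_i = 0}`. -/
def H (i : Fin n) : Set (Fin ℓ → ℝ) := {x | A.α i x = 0}

/-- The real complement of the subarrangement indexed by `s`. -/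
def compOn (s : Set (Fin n)) : Set (Fin ℓ → ℝ) := {x | ∀ i ∈ s, A.α i x ≠ 0}

/-- Chambers of the subarrangement indexed by `s` : connected components of its
real complement. -/
def IsChamberOn (s : Set (Fin n)) (C : Set (Fin ℓ → ℝ)) : Prop :=
  ∃ x ∈ A.compOn s, C = connectedComponentIn (A.compOn s) x

/-- Chambers of the full arrangement. -/
def IsChamber (C : Set (Fin ℓ → ℝ)) : Prop := A.IsChamberOn Set.univ C

/-- The intersection poset of the subarrangement indexed by `s` : nonempty
intersections of subfamilies (the empty intersection giving `ℝ^ℓ`). -/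
def LOn (s : Set (Fin n)) (X : Set (Fin ℓ → ℝ)) : Prop :=
  X.Nonempty ∧ ∃ t : Set (Fin n), t ⊆ s ∧ X = ⋂ i ∈ t, A.H i

/-- The intersection poset `L(A)`. -/
def L (X : Set (Fin ℓ → ℝ)) : Prop := A.LOn Set.univ X

/-- The real part of a point of `ℂ^ℓ`. -/
def reP {ℓ : ℕ} (z : Fin ℓ → ℂ) : Fin ℓ → ℝ := fun j => (z j).re

/-- The imaginary part of a point of `ℂ^ℓ`. -/
def imP {ℓ : ℕ} (z : Fin ℓ → ℂ) : Fin ℓ → ℝ := fun j => (z j).im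

/-- The point `x + iv` of `ℂ^ℓ`. -/
def mkC {ℓ : ℕ} (x v : Fin ℓ → ℝ) : Fin ℓ → ℂ := fun j => ⟨x j, v j⟩

/-- The complexified complement `M(A) = ℂ^ℓ \ ⋃ H_ℂ`; a point `x + iv` lies on
`H_ℂ = {α_ℂ = 0}` iff `α(x) = 0` and the linear part of `α` kills `v`. -/
def M : Set (Fin ℓ → ℂ) :=
  {z | ∀ i : Fin n, ¬(A.α i (reP z) = 0 ∧ (A.α i).linear (imP z) = 0)}

end Arrangement

/-- Dimension of a subset of `ℝ^ℓ` (for affine subspaces, their dimension). -/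
noncomputable def dimS {ℓ : ℕ} (X : Set (Fin ℓ → ℝ)) : ℕ :=
  Module.finrank ℝ (affineSpan ℝ X).direction

/-- The direction `τ(X)` of (the affine span of) a subset of `ℝ^ℓ`. -/
noncomputable def tau {ℓ : ℕ} (X : Set (Fin ℓ → ℝ)) : Submodule ℝ (Fin ℓ → ℝ) :=
  (affineSpan ℝ X).direction

/-- A flag in `ℝ^ℓ` given by defining affine-linear forms `h_1, …, h_ℓ`
(0-indexed: `h j` is the form `h_{j+1}`). -/
structure Flag (ℓ : ℕ) where
  h : Fin ℓ → ((Fin ℓ → ℝ) →ᵃ[ℝ] ℝ)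

namespace Flag

variable {ℓ : ℕ} (𝓕 : Flag ℓ)

/-- The flag subspace `F^q = {h_{q+1} = ⋯ = h_ℓ = 0}`. -/
def F (q : ℕ) : Set (Fin ℓ → ℝ) := {x | ∀ j : Fin ℓ, q ≤ (j : ℕ) → 𝓕.h j x = 0}

/-- `𝓕.hq q` is the form `h_q` in 1-indexed notation (junk value `0` out of range). -/
noncomputable def hq (q : ℕ) : (Fin ℓ → ℝ) →ᵃ[ℝ] ℝ :=
  if hlt : q - 1 < ℓ then 𝓕.h ⟨q - 1, hlt⟩ else 0

end Flag

/-- Genericity of the flag: for every `X ∈ L(A)`, `F^q ∩ X` is an affine subspace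
of dimension `q + dim X - ℓ`, empty when `q + dim X < ℓ`. -/
def GenericFlag {ℓ n : ℕ} (A : Arrangement ℓ n) (𝓕 : Flag ℓ) : Prop :=
  ∀ X, A.L X → ∀ q, q ≤ ℓ →
    (ℓ ≤ q + dimS X →
      ∃ W : AffineSubspace ℝ (Fin ℓ → ℝ), (W : Set (Fin ℓ → ℝ)).Nonempty ∧
        (W : Set (Fin ℓ → ℝ)) = 𝓕.F q ∩ X ∧
        Module.finrank ℝ W.direction = q + dimS X - ℓ) ∧
    (q + dimS X < ℓ → 𝓕.F q ∩ X = ∅)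

/-- Condition (1) of the Assumption, for the subarrangement indexed by `s`:
if a chamber `C` meets `F^q` but not `F^{q-1}`, then `h_q > 0` on `C ∩ F^q`. -/
def Cond1On {ℓ n : ℕ} (A : Arrangement ℓ n) (s : Set (Fin n)) (𝓕 : Flag ℓ) : Prop :=
  ∀ q : ℕ, 1 ≤ q → q ≤ ℓ → ∀ C, A.IsChamberOn s C →
    (C ∩ 𝓕.F q).Nonempty → C ∩ 𝓕.F (q - 1) = ∅ →
    ∀ x ∈ C ∩ 𝓕.F q, 0 < 𝓕.hq q x

/-- Condition (2) of the Assumption, for the subarrangement indexed by `s`: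
distinct `X, X'` in the intersection poset of dimension `ℓ - q` have different
`h_q`-values at their intersection points with `F^q`. -/
def Cond2On {ℓ n : ℕ} (A : Arrangement ℓ n) (s : Set (Fin n)) (𝓕 : Flag ℓ) : Prop :=
  ∀ q : ℕ, 1 ≤ q → q ≤ ℓ → ∀ X X', A.LOn s X → A.LOn s X' →
    dimS X = ℓ - q → dimS X' = ℓ - q → X ≠ X' →
    ∀ p ∈ X ∩ 𝓕.F q, ∀ p' ∈ X' ∩ 𝓕.F q, 𝓕.hq q p ≠ 𝓕.hq q p'

/-- `C ∈ ch^q_F(A)` : `C` is a chamber meeting `F^q` but not `F^{q-1}`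
(the latter condition being empty for `q = 0`, since `F^{-1} = ∅`). -/
def ChF {ℓ n : ℕ} (A : Arrangement ℓ n) (𝓕 : Flag ℓ) (q : ℕ)
    (C : Set (Fin ℓ → ℝ)) : Prop :=
  A.IsChamber C ∧ (C ∩ 𝓕.F q).Nonempty ∧ (q = 0 ∨ C ∩ 𝓕.F (q - 1) = ∅)

/-- `X = X_C` for `C ∈ ch^q_F(A)` : `X ∈ L(A)` has dimension `ℓ - q` and meets
`F^q` exactly in the unique minimum point of `h_q` on the closure of `C ∩ F^q`. -/
def IsXC {ℓ n : ℕ} (A : Arrangement ℓ n) (𝓕 : Flag ℓ) (q : ℕ)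
    (C X : Set (Fin ℓ → ℝ)) : Prop :=
  A.L X ∧ dimS X = ℓ - q ∧
  ∃ p : Fin ℓ → ℝ, X ∩ 𝓕.F q = {p} ∧ p ∈ closure (C ∩ 𝓕.F q) ∧
    ∀ y ∈ closure (C ∩ 𝓕.F q), 𝓕.hq q p ≤ 𝓕.hq q y

/-- Indices of the hyperplanes parallel to `X`, i.e. `A_{[X]} = {H : τ(X) ⊆ τ(H)}`. -/
def parIdx {ℓ n : ℕ} (A : Arrangement ℓ n) (X : Set (Fin ℓ → ℝ)) : Set (Fin n) :=
  {i | tau X ≤ LinearMap.ker (A.α i).linear}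

/-- `H_i ∈ Sep(C, C')` : the hyperplane `H_i` separates the chambers `C` and `C'`. -/
def SepCh {ℓ n : ℕ} (A : Arrangement ℓ n) (C C' : Set (Fin ℓ → ℝ)) (i : Fin n) : Prop :=
  ((∀ x ∈ C, 0 < A.α i x) ∧ (∀ y ∈ C', A.α i y < 0)) ∨
  ((∀ x ∈ C, A.α i x < 0) ∧ (∀ y ∈ C', 0 < A.α i y))

/-- `H_i ∈ Sep(p₁, p₂)` : the hyperplane `H_i` meets the segment `[p₁, p₂]`. -/
def SepPt {ℓ n : ℕ} (A : Arrangement ℓ n) (p₁ p₂ : Fin ℓ → ℝ) (i : Fin n) : Prop :=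
  ∃ w ∈ segment ℝ p₁ p₂, A.α i w = 0

/-- The piece `S(C)` attached to a chamber with `τ(X_C) = T` and base point `p`:
all `x + iv` with `v ∈ T` and `v ∉ τ(H)` for every `H ∈ Sep(p, x)`. -/
def S {ℓ n : ℕ} (A : Arrangement ℓ n) (T : Submodule ℝ (Fin ℓ → ℝ))
    (p : Fin ℓ → ℝ) : Set (Fin ℓ → ℂ) :=
  {z | Arrangement.imP z ∈ T ∧
    ∀ i : Fin n, SepPt A p (Arrangement.reP z) i →
      (A.α i).linear (Arrangement.imP z) ≠ 0}

end IY

namespace IY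
open Arrangement

section Helpers

variable {ℓ n : ℕ}

/-- `S` meets every `X ∈ L(A)` in an affine subspace of dimension `q + dim X - ℓ`, and in the
empty set when `q + dim X < ℓ`. -/
def GenericAt (A : Arrangement ℓ n) (q : ℕ) (S : Set (Fin ℓ → ℝ)) : Prop :=
  ∀ X, A.L X →
    (ℓ ≤ q + dimS X →
      ∃ W : AffineSubspace ℝ (Fin ℓ → ℝ), (W : Set (Fin ℓ → ℝ)).Nonempty ∧
        (W : Set (Fin ℓ → ℝ)) = S ∩ X ∧
        Module.finrank ℝ W.direction = q + dimS X - ℓ) ∧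
    (q + dimS X < ℓ → S ∩ X = ∅)

/-- The form `h` is nonconstant or positive on every section `S ∩ X`, and it separates the
sections that are points. -/
def GoodForm (A : Arrangement ℓ n) (S : Set (Fin ℓ → ℝ)) (h : (Fin ℓ → ℝ) →ᵃ[ℝ] ℝ) : Prop :=
  (∀ X, A.L X → (∃ a ∈ S ∩ X, ∃ b ∈ S ∩ X, h a ≠ h b) ∨
    ((S ∩ X).Subsingleton ∧ ∀ p ∈ S ∩ X, 0 < h p)) ∧
  ∀ X X', A.L X → A.L X' → ∀ p p', S ∩ X = {p} → S ∩ X' = {p'} → p ≠ p' → h p ≠ h p'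

lemma finite_setOf_L (A : Arrangement ℓ n) : {X | A.L X}.Finite := by
  refine (Set.finite_range fun t : Set (Fin n) => ⋂ i ∈ t, A.H i).subset ?_
  rintro X ⟨-, t, -, rfl⟩
  exact ⟨t, rfl⟩

lemma exists_affine_injOn_pos {P : Set (Fin ℓ → ℝ)} (hP : P.Finite) :
    ∃ h : (Fin ℓ → ℝ) →ᵃ[ℝ] ℝ, InjOn h P ∧ ∀ p ∈ P, 0 < h p := by
  have := hP.to_subtype
  obtain ⟨f, hf⟩ := Module.exists_dual_forall_apply_ne_zero (K := ℝ)
    (fun u : {u : P × P // u.1 ≠ u.2} => (u.1.1 : Fin ℓ → ℝ) - u.1.2)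
    (fun u => sub_ne_zero.2 fun h => u.2 (Subtype.ext h))
  obtain ⟨c, hc⟩ := (hP.image f).bddBelow
  refine ⟨f.toAffineMap + AffineMap.const ℝ _ (1 - c), fun a ha b hb hab => ?_, fun p hp => ?_⟩
  · by_contra hne
    refine hf ⟨(⟨a, ha⟩, ⟨b, hb⟩), fun h => hne (congrArg Subtype.val h)⟩ ?_
    simpa [sub_eq_zero] using hab
  · have : c ≤ f p := hc ⟨p, hp, rfl⟩
    simp only [AffineMap.coe_add, LinearMap.coe_toAffineMap, Pi.add_apply, AffineMap.const_apply]
    linarith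

lemma exists_goodForm (A : Arrangement ℓ n) (S : Set (Fin ℓ → ℝ)) : ∃ h, GoodForm A S h := by
  have key : ∀ X : Set (Fin ℓ → ℝ), ∃ P : Set (Fin ℓ → ℝ), P.Finite ∧
      ((∃ a ∈ S ∩ X, ∃ b ∈ S ∩ X, a ≠ b ∧ a ∈ P ∧ b ∈ P) ∨
        ((S ∩ X).Subsingleton ∧ S ∩ X ⊆ P)) := by
    intro X
    rcases (S ∩ X).subsingleton_or_nontrivial with h | ⟨a, ha, b, hb, hab⟩
    · exact ⟨S ∩ X, h.finite, Or.inr ⟨h, subset_rfl⟩⟩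
    · exact ⟨{a, b}, by simp, Or.inl ⟨a, ha, b, hb, hab, by simp, by simp⟩⟩
  choose P hPfin hP using key
  obtain ⟨h, hinj, hpos⟩ := exists_affine_injOn_pos
    ((finite_setOf_L A).biUnion fun X _ => hPfin X)
  have hsub : ∀ X, A.L X → P X ⊆ ⋃ X ∈ {X | A.L X}, P X :=
    fun X hX => subset_biUnion_of_mem (u := P) hX
  have hpt : ∀ X, A.L X → ∀ p, S ∩ X = {p} → p ∈ ⋃ X ∈ {X | A.L X}, P X := by
    intro X hX p hp
    rcases hP X with ⟨a, ha, b, hb, hab, -⟩ | ⟨-, hs⟩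
    · rw [hp] at ha hb
      exact absurd (ha.trans hb.symm) hab
    · exact hsub X hX (hs (hp ▸ rfl))
  refine ⟨h, fun X hX => ?_, fun X X' hX hX' p p' hp hp' hne heq =>
    hne (hinj (hpt X hX p hp) (hpt X' hX' p' hp') heq)⟩
  rcases hP X with ⟨a, ha, b, hb, hab, haP, hbP⟩ | ⟨hs, hsP⟩
  · exact Or.inl ⟨a, ha, b, hb, fun he => hab (hinj (hsub X hX haP) (hsub X hX hbP) he)⟩
  · exact Or.inr ⟨hs, fun p hp => hpos p (hsub X hX (hsP hp))⟩

lemma exists_affineSubspace_eq {A : Arrangement ℓ n} {X : Set (Fin ℓ → ℝ)} (hX : A.L X) :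
    ∃ U : AffineSubspace ℝ (Fin ℓ → ℝ), (U : Set (Fin ℓ → ℝ)) = X := by
  obtain ⟨-, t, -, rfl⟩ := hX
  refine ⟨⨅ i ∈ t, (AffineSubspace.mk' (0 : ℝ) ⊥).comap (A.α i), ?_⟩
  ext x
  simp [H, AffineSubspace.mem_mk']

lemma dimS_coe (U : AffineSubspace ℝ (Fin ℓ → ℝ)) :
    dimS (U : Set (Fin ℓ → ℝ)) = Module.finrank ℝ U.direction := by
  rw [dimS, AffineSubspace.affineSpan_coe]

lemma L_univ (A : Arrangement ℓ n) : A.L univ :=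
  ⟨univ_nonempty, ∅, by simp, by simp⟩

lemma dimS_univ : dimS (univ : Set (Fin ℓ → ℝ)) = ℓ := by
  rw [dimS, AffineSubspace.span_univ, AffineSubspace.direction_top, finrank_top,
    Module.finrank_fin_fun]

lemma genericAt_univ (A : Arrangement ℓ n) : GenericAt A ℓ univ := by
  intro X hX
  obtain ⟨U, rfl⟩ := exists_affineSubspace_eq hX
  refine ⟨fun _ => ⟨U, hX.1, by simp, ?_⟩, fun h => by omega⟩
  rw [dimS_coe]
  omega

lemma exists_affineSubspace_inter_zero (W : AffineSubspace ℝ (Fin ℓ → ℝ))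
    (h : (Fin ℓ → ℝ) →ᵃ[ℝ] ℝ) {a b : Fin ℓ → ℝ} (ha : a ∈ W) (hb : b ∈ W) (hab : h a ≠ h b) :
    ∃ W' : AffineSubspace ℝ (Fin ℓ → ℝ), (W' : Set (Fin ℓ → ℝ)).Nonempty ∧
      (W' : Set (Fin ℓ → ℝ)) = (W : Set (Fin ℓ → ℝ)) ∩ {x | h x = 0} ∧
      Module.finrank ℝ W'.direction + 1 = Module.finrank ℝ W.direction := by
  have hba : h b - h a ≠ 0 := sub_ne_zero.2 hab.symm
  obtain ⟨p, hpW, hp⟩ : ∃ p ∈ W, h p = 0 := by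
    refine ⟨AffineMap.lineMap a b (-h a / (h b - h a)), AffineMap.lineMap_mem _ ha hb, ?_⟩
    rw [AffineMap.apply_lineMap, AffineMap.lineMap_apply_ring']
    field_simp
    ring
  have hmem : ∀ x, x ∈ AffineSubspace.mk' p (W.direction ⊓ LinearMap.ker h.linear) ↔
      x ∈ W ∧ h x = 0 := by
    intro x
    rw [AffineSubspace.mem_mk', Submodule.mem_inf, LinearMap.mem_ker, AffineMap.linearMap_vsub,
      AffineSubspace.vsub_right_mem_direction_iff_mem hpW, hp]
    simp
  refine ⟨AffineSubspace.mk' p (W.direction ⊓ LinearMap.ker h.linear),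
    ⟨p, (hmem p).2 ⟨hpW, hp⟩⟩, Set.ext hmem, ?_⟩
  have hne : h.linear.domRestrict W.direction ≠ 0 := by
    intro h0
    have := LinearMap.congr_fun h0 ⟨b -ᵥ a, AffineSubspace.vsub_mem_direction hb ha⟩
    rw [LinearMap.domRestrict_apply, AffineMap.linearMap_vsub] at this
    exact hba this
  rw [AffineSubspace.direction_mk', ← Module.Dual.finrank_ker_add_one_of_ne_zero hne,
    LinearMap.ker_domRestrict, ← Submodule.map_comap_subtype]
  rw [LinearEquiv.finrank_eq (Submodule.equivSubtypeMap _ _)]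

lemma GenericAt.inter_zero {A : Arrangement ℓ n} {q : ℕ} {S : Set (Fin ℓ → ℝ)}
    {h : (Fin ℓ → ℝ) →ᵃ[ℝ] ℝ} (hS : GenericAt A (q + 1) S) (hh : GoodForm A S h) :
    GenericAt A q (S ∩ {x | h x = 0}) := by
  intro X hX
  rw [inter_right_comm]
  obtain ⟨h1, h2⟩ := hS X hX
  rcases lt_or_ge (q + 1 + dimS X) ℓ with hlt | hge
  · exact ⟨fun _ => by omega, fun _ => by rw [h2 hlt, empty_inter]⟩
  obtain ⟨W, hWne, hW, hWd⟩ := h1 hge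
  rcases hh.1 X hX with ⟨a, ha, b, hb, hab⟩ | ⟨hs, hpos⟩
  · rw [← hW] at ha hb ⊢
    obtain ⟨W', hne, heq, hd⟩ := exists_affineSubspace_inter_zero W h ha hb hab
    exact ⟨fun _ => ⟨W', hne, heq, by omega⟩, fun _ => by omega⟩
  · have h0 : Module.finrank ℝ W.direction = 0 := by
      rw [Submodule.finrank_eq_zero, AffineSubspace.direction_eq_vectorSpan,
        vectorSpan_of_subsingleton ℝ (hW ▸ hs)]
    refine ⟨fun _ => by omega, fun _ => eq_empty_of_forall_notMem ?_⟩
    rintro x ⟨hx, hx0⟩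
    exact (hpos x hx).ne' hx0

lemma GenericAt.exists_inter_eq_singleton {A : Arrangement ℓ n} {q : ℕ} {S X : Set (Fin ℓ → ℝ)}
    (hS : GenericAt A q S) (hX : A.L X) (hd : q + dimS X = ℓ) {p : Fin ℓ → ℝ}
    (hp : p ∈ S ∩ X) : S ∩ X = {p} := by
  obtain ⟨W, -, hW, hWd⟩ := (hS X hX).1 hd.ge
  rw [hd, Nat.sub_self, Submodule.finrank_eq_zero] at hWd
  rw [← hW] at hp ⊢
  refine Subset.antisymm (fun x hx => ?_) (by simpa using hp)
  have := AffineSubspace.vsub_mem_direction hx hp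
  rwa [hWd, Submodule.mem_bot, vsub_eq_zero_iff_eq] at this

lemma L_inter {A : Arrangement ℓ n} {X X' : Set (Fin ℓ → ℝ)} (hX : A.L X) (hX' : A.L X')
    (hne : (X ∩ X').Nonempty) : A.L (X ∩ X') := by
  obtain ⟨-, t, -, rfl⟩ := hX
  obtain ⟨-, t', -, rfl⟩ := hX'
  exact ⟨hne, t ∪ t', subset_univ _, (biInter_union t t' A.H).symm⟩

lemma dimS_inter_lt {A : Arrangement ℓ n} {X X' : Set (Fin ℓ → ℝ)} (hX : A.L X) (hX' : A.L X')
    (hd : dimS X = dimS X') (hXX' : X ≠ X') (hne : (X ∩ X').Nonempty) :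
    dimS (X ∩ X') < dimS X := by
  obtain ⟨U, rfl⟩ := exists_affineSubspace_eq hX
  obtain ⟨U', rfl⟩ := exists_affineSubspace_eq hX'
  have hinf : (U : Set (Fin ℓ → ℝ)) ∩ U' = (U ⊓ U' : AffineSubspace ℝ (Fin ℓ → ℝ)) := rfl
  rw [hinf] at hne ⊢
  rw [dimS_coe, dimS_coe] at hd ⊢
  refine Submodule.finrank_lt_finrank_of_lt
    (AffineSubspace.direction_lt_of_nonempty (lt_of_le_of_ne inf_le_left fun h => hXX' ?_) hne)
  have hle := inf_eq_left.1 h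
  rw [AffineSubspace.eq_of_direction_eq_of_nonempty_of_le
    (Submodule.eq_of_le_of_finrank_eq (AffineSubspace.direction_le hle) hd) hX.1 hle]

lemma GoodForm.apply_ne {A : Arrangement ℓ n} {q : ℕ} {S : Set (Fin ℓ → ℝ)}
    {h : (Fin ℓ → ℝ) →ᵃ[ℝ] ℝ} (hh : GoodForm A S h) (hS : GenericAt A q S)
    {X X' : Set (Fin ℓ → ℝ)} (hX : A.L X) (hX' : A.L X') (hd : q + dimS X = ℓ)
    (hd' : q + dimS X' = ℓ) (hXX' : X ≠ X') {p p' : Fin ℓ → ℝ} (hp : p ∈ S ∩ X)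
    (hp' : p' ∈ S ∩ X') : h p ≠ h p' := by
  refine hh.2 X X' hX hX' p p' (hS.exists_inter_eq_singleton hX hd hp)
    (hS.exists_inter_eq_singleton hX' hd' hp') ?_
  rintro rfl
  have hne : (X ∩ X').Nonempty := ⟨p, hp.2, hp'.2⟩
  have hlt := dimS_inter_lt hX hX' (by omega) hXX' hne
  have := (hS _ (L_inter hX hX' hne)).2 (by omega)
  exact (this ▸ (⟨hp.1, hp.2, hp'.2⟩ : p ∈ S ∩ (X ∩ X')) : p ∈ (∅ : Set _))

/-- In the closed cell of sign `s` there is a point of `W` where `h` is positive. -/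
lemma exists_pos_of_weak (A : Arrangement ℓ n) (W : AffineSubspace ℝ (Fin ℓ → ℝ))
    {h : (Fin ℓ → ℝ) →ᵃ[ℝ] ℝ} (hh : GoodForm A W h) (s : Fin n → ℝ) (y : Fin ℓ → ℝ)
    (hyW : y ∈ W) (hy : ∀ i, 0 ≤ s i * A.α i y) :
    ∃ z ∈ W, (∀ i, 0 ≤ s i * A.α i z) ∧ 0 < h z := by
  classical
  induction hm : (Finset.univ.filter fun i => A.α i y ≠ 0).card using Nat.strong_induction_on
    generalizing y with
  | _ m ih =>
  have hyX : y ∈ ⋂ i ∈ {i | A.α i y = 0}, A.H i := by simp [H]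
  rcases hh.1 _ ⟨⟨y, hyX⟩, {i | A.α i y = 0}, subset_univ _, rfl⟩ with
    ⟨a, ha, b, hb, hab⟩ | ⟨-, hpos⟩
  swap
  · exact ⟨y, hyW, hy, hpos y ⟨hyW, hyX⟩⟩
  wlog hlt : h a < h b generalizing a b
  · exact this b hb a ha hab.symm (lt_of_le_of_ne (not_lt.1 hlt) hab.symm)
  have hmove : ∀ (f : (Fin ℓ → ℝ) →ᵃ[ℝ] ℝ) (t : ℝ),
      f (t • (b - a) + y) = f y + t * (f b - f a) := by
    intro f t
    have h1 := f.map_vadd y (t • (b - a))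
    have h2 := f.linearMap_vsub b a
    simp only [vadd_eq_add, vsub_eq_sub, map_smul, smul_eq_mul] at h1 h2
    rw [h1, h2]
    ring
  have hmoveW : ∀ t : ℝ, t • (b - a) + y ∈ W := fun t =>
    AffineSubspace.vadd_mem_of_mem_direction
      (Submodule.smul_mem _ t (AffineSubspace.vsub_mem_direction hb.1 ha.1)) hyW
  by_cases hJ : ∃ i, s i * (A.α i b - A.α i a) < 0
  · obtain ⟨i₀, hi₀, hmin⟩ := Finset.exists_min_image
      (Finset.univ.filter fun i => s i * (A.α i b - A.α i a) < 0)
      (fun i => s i * A.α i y / -(s i * (A.α i b - A.α i a)))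
      (by simpa [Finset.filter_nonempty_iff] using hJ)
    simp only [Finset.mem_filter, Finset.mem_univ, true_and] at hi₀ hmin
    set t := s i₀ * A.α i₀ y / -(s i₀ * (A.α i₀ b - A.α i₀ a)) with ht
    have ht0 : 0 ≤ t := div_nonneg (hy i₀) (by linarith)
    have hz : ∀ i, 0 ≤ s i * A.α i (t • (b - a) + y) := by
      intro i
      rw [hmove]
      by_cases hi : s i * (A.α i b - A.α i a) < 0
      · have := (le_div_iff₀ (by linarith)).1 (hmin i hi)
        linarith
      · nlinarith [mul_nonneg ht0 (not_lt.1 hi), hy i]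
    refine ih _ ?_ (t • (b - a) + y) (hmoveW t) hz rfl
    rw [← hm]
    have hzero : ∀ i, A.α i y = 0 → A.α i a = 0 ∧ A.α i b = 0 := fun i hi =>
      ⟨mem_iInter₂.1 ha.2 i hi, mem_iInter₂.1 hb.2 i hi⟩
    have hs0 : s i₀ ≠ 0 := by
      rintro h0
      simp [h0] at hi₀
    refine Finset.card_lt_card (Finset.ssubset_iff_of_subset ?_ |>.2 ⟨i₀, ?_, ?_⟩)
    · intro i
      simp only [Finset.mem_filter, Finset.mem_univ, true_and]
      intro hi h0
      obtain ⟨h1, h2⟩ := hzero i h0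
      exact hi (by rw [hmove, h0, h1, h2]; ring)
    · simp only [Finset.mem_filter, Finset.mem_univ, true_and]
      intro h0
      obtain ⟨h1, h2⟩ := hzero i₀ h0
      simp [h1, h2] at hi₀
    · simp only [Finset.mem_filter, Finset.mem_univ, true_and, not_not]
      rw [hmove]
      have hmul : s i₀ * (A.α i₀ y + t * (A.α i₀ b - A.α i₀ a)) = 0 := by
        have : t * -(s i₀ * (A.α i₀ b - A.α i₀ a)) = s i₀ * A.α i₀ y :=
          div_mul_cancel₀ _ (by linarith)
        linarith
      exact (mul_eq_zero.1 hmul).resolve_left hs0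
  · push Not at hJ
    have hba : 0 < h b - h a := sub_pos.2 hlt
    have ht0 : 0 ≤ (|h y| + 1) / (h b - h a) := by positivity
    refine ⟨((|h y| + 1) / (h b - h a)) • (b - a) + y, hmoveW _, fun i => ?_, ?_⟩
    · rw [hmove]
      nlinarith [mul_nonneg ht0 (hJ i), hy i]
    · rw [hmove, div_mul_cancel₀ _ hba.ne']
      linarith [neg_abs_le (h y)]

lemma exists_strict_zero (A : Arrangement ℓ n) (W : AffineSubspace ℝ (Fin ℓ → ℝ))
    {h : (Fin ℓ → ℝ) →ᵃ[ℝ] ℝ} (hh : GoodForm A W h) {x : Fin ℓ → ℝ} (hxW : x ∈ W)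
    (hx : ∀ i, A.α i x ≠ 0) (hneg : h x ≤ 0) :
    ∃ z ∈ W, (∀ i, 0 < A.α i x * A.α i z) ∧ h z = 0 := by
  obtain ⟨y, hyW, hy, hpos⟩ := exists_pos_of_weak A W hh (fun i => A.α i x) x hxW
    fun i => mul_self_nonneg _
  have hd : 0 < h y - h x := by linarith
  have ht0 : 0 ≤ -h x / (h y - h x) := div_nonneg (by linarith) hd.le
  have ht1 : -h x / (h y - h x) < 1 := by
    rw [div_lt_one hd]
    linarith
  refine ⟨AffineMap.lineMap x y (-h x / (h y - h x)), AffineMap.lineMap_mem _ hxW hyW,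
    fun i => ?_, ?_⟩
  · rw [AffineMap.apply_lineMap, AffineMap.lineMap_apply_ring]
    have h1 := mul_pos (sub_pos.2 ht1) (mul_self_pos.2 (hx i))
    have h2 := mul_nonneg ht0 (hy i)
    linarith
  · rw [AffineMap.apply_lineMap, AffineMap.lineMap_apply_ring', div_mul_cancel₀ _ hd.ne']
    ring

lemma mem_chamber_of_same_sign {A : Arrangement ℓ n} {C : Set (Fin ℓ → ℝ)} (hC : A.IsChamber C)
    {x z : Fin ℓ → ℝ} (hx : x ∈ C) (hz : ∀ i, 0 < A.α i x * A.α i z) : z ∈ C := by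
  obtain ⟨x₀, -, rfl⟩ := hC
  rw [connectedComponentIn_eq hx]
  have hxc : ∀ i, A.α i x ≠ 0 := fun i h0 => by simpa [h0] using hz i
  have hconv : Convex ℝ {y | ∀ i, 0 < A.α i x * A.α i y} := by
    rw [ofPred_forall]
    exact convex_iInter fun i =>
      (convex_Ioi (0 : ℝ)).affine_preimage (A.α i x • A.α i)
  refine hconv.isPreconnected.subset_connectedComponentIn
    (fun i => mul_self_pos.2 (hxc i)) ?_ hz
  intro y hy i _ h0
  simpa [h0] using hy i

lemma GoodForm.pos_of_chamber {A : Arrangement ℓ n} {S : Set (Fin ℓ → ℝ)} {q : ℕ}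
    {h : (Fin ℓ → ℝ) →ᵃ[ℝ] ℝ} (hh : GoodForm A S h) (hS : GenericAt A q S)
    {C : Set (Fin ℓ → ℝ)} (hC : A.IsChamber C) (hempty : C ∩ (S ∩ {x | h x = 0}) = ∅)
    {x : Fin ℓ → ℝ} (hx : x ∈ C ∩ S) : 0 < h x := by
  obtain ⟨W, -, hW, -⟩ := (hS univ (L_univ A)).1 (by rw [dimS_univ]; omega)
  rw [inter_univ] at hW
  subst hW
  by_contra! hneg
  have hxc : ∀ i, A.α i x ≠ 0 := by
    obtain ⟨x₀, -, rfl⟩ := hC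
    exact fun i => connectedComponentIn_subset _ _ hx.1 i (mem_univ i)
  obtain ⟨z, hzW, hz, hz0⟩ := exists_strict_zero A W hh hx.2 hxc hneg
  exact eq_empty_iff_forall_notMem.1 hempty z
    ⟨mem_chamber_of_same_sign hC hx.1 hz, hzW, hz0⟩

lemma Flag.F_self (𝓕 : Flag ℓ) : 𝓕.F ℓ = univ :=
  eq_univ_of_forall fun _ j hj => absurd j.2 (not_lt.2 hj)

lemma Flag.F_eq_inter (𝓕 : Flag ℓ) {q : ℕ} (hq : q < ℓ) :
    𝓕.F q = 𝓕.F (q + 1) ∩ {x | 𝓕.h ⟨q, hq⟩ x = 0} := by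
  ext x
  refine ⟨fun hx => ⟨fun j hj => hx j (by omega), hx ⟨q, hq⟩ le_rfl⟩, fun hx j hj => ?_⟩
  rcases hj.eq_or_lt with rfl | hlt
  · exact hx.2
  · exact hx.1 j hlt

lemma exists_flag_goodForm (A : Arrangement ℓ n) :
    ∃ 𝓕 : Flag ℓ, ∀ j : Fin ℓ, GoodForm A (𝓕.F (j + 1)) (𝓕.h j) := by
  choose f hf using exists_goodForm A
  let T : ℕ → Set (Fin ℓ → ℝ) := fun k => Nat.rec univ (fun _ S => S ∩ {x | f S x = 0}) k
  have hT : ∀ k, T (k + 1) = T k ∩ {x | f (T k) x = 0} := fun _ => rfl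
  let 𝓕 : Flag ℓ := ⟨fun j => f (T (ℓ - 1 - j))⟩
  have hF : ∀ k ≤ ℓ, 𝓕.F (ℓ - k) = T k := by
    intro k
    induction k with
    | zero => exact fun _ => 𝓕.F_self
    | succ k ih =>
      intro hk
      rw [𝓕.F_eq_inter (by omega), hT, show ℓ - (k + 1) + 1 = ℓ - k by omega, ih (by omega)]
      simp only [𝓕, show ℓ - 1 - (ℓ - (k + 1)) = k by omega]
  refine ⟨𝓕, fun j => ?_⟩
  have := hF (ℓ - 1 - j) (by omega)
  rw [show ℓ - (ℓ - 1 - j) = (j : ℕ) + 1 by omega] at this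
  rw [this]
  exact hf _

lemma genericAt_F {A : Arrangement ℓ n} {𝓕 : Flag ℓ}
    (h𝓕 : ∀ j : Fin ℓ, GoodForm A (𝓕.F (j + 1)) (𝓕.h j)) {q : ℕ} (hq : q ≤ ℓ) :
    GenericAt A q (𝓕.F q) := by
  induction hq using Nat.decreasingInduction with
  | self => rw [𝓕.F_self]; exact genericAt_univ A
  | of_succ q hq ih =>
    rw [𝓕.F_eq_inter hq]
    exact ih.inter_zero (h𝓕 ⟨q, hq⟩)

end Helpers

/-- Every real arrangement admits a generic flag (with
`dim F^q = q`) satisfying conditions (1) and (2) of the Assumption. -/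
theorem exists_good_flag (ℓ n : ℕ) (A : Arrangement ℓ n) :
    ∃ 𝓕 : Flag ℓ,
      (∀ q ≤ ℓ, ∃ W : AffineSubspace ℝ (Fin ℓ → ℝ),
          (W : Set (Fin ℓ → ℝ)) = 𝓕.F q ∧ (W : Set (Fin ℓ → ℝ)).Nonempty ∧
          Module.finrank ℝ W.direction = q) ∧
      GenericFlag A 𝓕 ∧ Cond1On A Set.univ 𝓕 ∧ Cond2On A Set.univ 𝓕 := by
  obtain ⟨𝓕, h𝓕⟩ := exists_flag_goodForm A
  have hgen : ∀ q ≤ ℓ, GenericAt A q (𝓕.F q) := fun q hq => genericAt_F h𝓕 hq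
  refine ⟨𝓕, fun q hq => ?_, fun X hX q hq => hgen q hq X hX, ?_, ?_⟩
  · obtain ⟨W, hne, hW, hd⟩ := (hgen q hq univ (L_univ A)).1 (by rw [dimS_univ]; omega)
    rw [dimS_univ] at hd
    exact ⟨W, by rw [hW, inter_univ], hne, by omega⟩
  · intro q hq1 hq C hC _ hempty x hx
    obtain ⟨q, rfl⟩ := Nat.exists_eq_add_of_le' hq1
    rw [Nat.add_sub_cancel, 𝓕.F_eq_inter hq] at hempty
    have := (h𝓕 ⟨q, hq⟩).pos_of_chamber (hgen (q + 1) hq) hC hempty hx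
    simpa [Flag.hq, show q < ℓ from hq] using this
  · intro q hq1 hq X X' hX hX' hd hd' hne p hp p' hp'
    obtain ⟨q, rfl⟩ := Nat.exists_eq_add_of_le' hq1
    have := (h𝓕 ⟨q, hq⟩).apply_ne (hgen (q + 1) hq) hX hX' (by omega) (by omega) hne
      ⟨hp.2, hp.1⟩ ⟨hp'.2, hp'.1⟩
    simpa [Flag.hq, show q < ℓ from hq] using this

end IY
end

section
/- Let I = {i_1, …, i_q} ⊆ {1, …, n} be such that the hyperplanes H_{i_1}, …, H_{i_q} ∈ A are independent, i.e. the intersection X(I) = H_{i_1} ∩ ⋯ ∩ H_{i_q} is nonempty of dimension ℓ − q. Then the subarrangement A(I) = {H_{i_1}, …, H_{i_q}} has exactly 2^q chambers (connected components of ℝ^ℓ \ ⋃_{k=1}^q H_{i_k}), and exactly one chamber C_0(I) of A(I) satisfies C_0(I) ∩ F^{q−1} = ∅. -/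
open Set

namespace IY
open Arrangement

section

variable {ℓ n : ℕ}

/-- The linear parts of the forms indexed by `J`, bundled as one linear map. -/
def linearForms (A : Arrangement ℓ n) (J : Finset (Fin n)) : (Fin ℓ → ℝ) →ₗ[ℝ] (J → ℝ) :=
  LinearMap.pi fun j => (A.α j).linear

lemma affineForm_sub (f : (Fin ℓ → ℝ) →ᵃ[ℝ] ℝ) (x y : Fin ℓ → ℝ) :
    f.linear (x - y) = f x - f y := by
  simpa using f.linearMap_vsub x y

lemma affineForm_sum (f : (Fin ℓ → ℝ) →ᵃ[ℝ] ℝ) {ι : Type*} (s : Finset ι) (t : ι → ℝ)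
    (p : ι → Fin ℓ → ℝ) :
    f.linear (∑ i ∈ s, t i • p i) = ∑ i ∈ s, t i * f (p i) - (∑ i ∈ s, t i) * f 0 := by
  have h : ∀ i, f.linear (p i) = f (p i) - f 0 := fun i => by
    simpa using affineForm_sub f (p i) 0
  simp only [map_sum, map_smul, h, smul_eq_mul, mul_sub, Finset.sum_sub_distrib, Finset.sum_mul]

lemma affineForm_affineComb (f : (Fin ℓ → ℝ) →ᵃ[ℝ] ℝ) {ι : Type*} (s : Finset ι) (t : ι → ℝ)
    (p : ι → Fin ℓ → ℝ) (ht : ∑ i ∈ s, t i = 1) :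
    f (∑ i ∈ s, t i • p i) = ∑ i ∈ s, t i * f (p i) := by
  have h := affineForm_sum f s t p
  have h' := affineForm_sub f (∑ i ∈ s, t i • p i) 0
  rw [sub_zero] at h'
  rw [ht, one_mul] at h
  linarith

lemma mem_iInter_H (A : Arrangement ℓ n) (J : Finset (Fin n)) (x : Fin ℓ → ℝ) :
    x ∈ ⋂ i ∈ J, A.H i ↔ ∀ i ∈ J, A.α i x = 0 := by
  simp [H]

lemma iInter_H_eq_mk' (A : Arrangement ℓ n) (J : Finset (Fin n)) {x₀ : Fin ℓ → ℝ}
    (hx₀ : x₀ ∈ ⋂ i ∈ J, A.H i) :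
    (⋂ i ∈ J, A.H i) = AffineSubspace.mk' x₀ (LinearMap.ker (linearForms A J)) := by
  rw [mem_iInter_H] at hx₀
  ext x
  simp only [mem_iInter_H, SetLike.mem_coe, AffineSubspace.mem_mk', LinearMap.mem_ker,
    vsub_eq_sub, linearForms, funext_iff, LinearMap.pi_apply, affineForm_sub, Subtype.forall,
    Pi.zero_apply]
  exact forall₂_congr fun i hi => by rw [hx₀ i hi, sub_zero]

lemma finrank_range_add_dimS (A : Arrangement ℓ n) (J : Finset (Fin n))
    (hne : (⋂ i ∈ J, A.H i).Nonempty) :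
    Module.finrank ℝ (LinearMap.range (linearForms A J)) + dimS (⋂ i ∈ J, A.H i) = ℓ := by
  obtain ⟨x₀, hx₀⟩ := hne
  rw [dimS, iInter_H_eq_mk' A J hx₀, AffineSubspace.affineSpan_coe, AffineSubspace.direction_mk',
    LinearMap.finrank_range_add_finrank_ker, Module.finrank_fin_fun]

lemma le_card_add_dimS (A : Arrangement ℓ n) (J : Finset (Fin n))
    (hne : (⋂ i ∈ J, A.H i).Nonempty) : ℓ ≤ J.card + dimS (⋂ i ∈ J, A.H i) := by
  have h := finrank_range_add_dimS A J hne
  have h' := (LinearMap.range (linearForms A J)).finrank_le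
  rw [Module.finrank_fintype_fun_eq_card, Fintype.card_coe] at h'
  omega

lemma L_iInter (A : Arrangement ℓ n) (J : Finset (Fin n)) (hne : (⋂ i ∈ J, A.H i).Nonempty) :
    A.L (⋂ i ∈ J, A.H i) :=
  ⟨hne, J, subset_univ _, by simp⟩

lemma exists_forms_eq (A : Arrangement ℓ n) (I : Finset (Fin n)) (hcard : I.card ≤ ℓ)
    (hne : (⋂ i ∈ I, A.H i).Nonempty) (hdim : dimS (⋂ i ∈ I, A.H i) = ℓ - I.card)
    (y : Fin n → ℝ) : ∃ x, ∀ i ∈ I, A.α i x = y i := by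
  have h := finrank_range_add_dimS A I hne
  have hsurj : Function.Surjective (linearForms A I) := by
    rw [← LinearMap.range_eq_top]
    apply Submodule.eq_top_of_finrank_eq
    rw [Module.finrank_fintype_fun_eq_card, Fintype.card_coe]
    omega
  obtain ⟨x₀, hx₀⟩ := hne
  rw [mem_iInter_H] at hx₀
  obtain ⟨v, hv⟩ := hsurj fun i => y i
  refine ⟨v + x₀, fun i hi => ?_⟩
  have h₁ : (A.α i).linear v = y i := congrFun hv ⟨i, hi⟩
  have h₂ := affineForm_sub (A.α i) (v + x₀) x₀
  rw [add_sub_cancel_right, h₁, hx₀ i hi, sub_zero] at h₂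
  exact h₂.symm

/-- The region of the complement of `A(I)` where exactly the forms indexed by `S` are positive. -/
def cell (A : Arrangement ℓ n) (I S : Finset (Fin n)) : Set (Fin ℓ → ℝ) :=
  {x | ∀ i ∈ I, A.α i x ≠ 0 ∧ (0 < A.α i x ↔ i ∈ S)}

lemma convex_cell (A : Arrangement ℓ n) (I S : Finset (Fin n)) : Convex ℝ (cell A I S) := by
  intro x hx y hy a b ha hb hab i hi
  obtain ⟨hx₀, hxS⟩ := hx i hi
  obtain ⟨hy₀, hyS⟩ := hy i hi
  have h : A.α i (a • x + b • y) = a * A.α i x + b * A.α i y :=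
    Convex.combo_affine_apply hab
  rw [h]
  by_cases hS : i ∈ S
  · have h₁ := hxS.2 hS
    have h₂ := hyS.2 hS
    have : 0 < a * A.α i x + b * A.α i y := convex_Ioi (0 : ℝ) h₁ h₂ ha hb hab
    exact ⟨this.ne', by simp [hS, this]⟩
  · have h₁ := lt_of_le_of_ne (not_lt.1 (mt hxS.1 hS)) hx₀
    have h₂ := lt_of_le_of_ne (not_lt.1 (mt hyS.1 hS)) hy₀
    have : a * A.α i x + b * A.α i y < 0 := convex_Iio (0 : ℝ) h₁ h₂ ha hb hab
    exact ⟨this.ne, by simp [hS, this.le]⟩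

lemma cell_subset_compOn (A : Arrangement ℓ n) (I S : Finset (Fin n)) :
    cell A I S ⊆ A.compOn I :=
  fun _ hx i hi => (hx i hi).1

lemma pos_of_isPreconnected {C : Set (Fin ℓ → ℝ)} (hC : IsPreconnected C)
    (f : (Fin ℓ → ℝ) →ᵃ[ℝ] ℝ) (hf : ∀ x ∈ C, f x ≠ 0) {x y : Fin ℓ → ℝ} (hx : x ∈ C)
    (hy : y ∈ C) (hpos : 0 < f x) : 0 < f y := by
  by_contra hle
  obtain ⟨z, hz, hz₀⟩ := hC.intermediate_value hy hx f.continuous_of_finiteDimensional.continuousOn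
    ⟨not_lt.1 hle, hpos.le⟩
  exact hf z hz hz₀

lemma connectedComponentIn_compOn (A : Arrangement ℓ n) (I S : Finset (Fin n)) {x : Fin ℓ → ℝ}
    (hx : x ∈ cell A I S) : connectedComponentIn (A.compOn I) x = cell A I S := by
  apply Subset.antisymm
  · intro y hy i hi
    have hne : ∀ z ∈ connectedComponentIn (A.compOn I) x, A.α i z ≠ 0 := fun z hz =>
      connectedComponentIn_subset _ _ hz i hi
    have hxC := mem_connectedComponentIn (cell_subset_compOn A I S hx)
    refine ⟨hne y hy, Iff.trans ⟨fun h => ?_, fun h => ?_⟩ (hx i hi).2⟩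
    · exact pos_of_isPreconnected isPreconnected_connectedComponentIn _ hne hy hxC h
    · exact pos_of_isPreconnected isPreconnected_connectedComponentIn _ hne hxC hy h
  · exact (convex_cell A I S).isPreconnected.subset_connectedComponentIn hx
      (cell_subset_compOn A I S)

lemma cell_nonempty (A : Arrangement ℓ n) (I S : Finset (Fin n)) (hcard : I.card ≤ ℓ)
    (hne : (⋂ i ∈ I, A.H i).Nonempty) (hdim : dimS (⋂ i ∈ I, A.H i) = ℓ - I.card) :
    (cell A I S).Nonempty := by
  obtain ⟨x, hx⟩ := exists_forms_eq A I hcard hne hdim fun i => if i ∈ S then 1 else -1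
  refine ⟨x, fun i hi => ?_⟩
  rw [hx i hi]
  split_ifs with h <;> norm_num [h]

lemma cell_injOn (A : Arrangement ℓ n) (I : Finset (Fin n)) (hcard : I.card ≤ ℓ)
    (hne : (⋂ i ∈ I, A.H i).Nonempty) (hdim : dimS (⋂ i ∈ I, A.H i) = ℓ - I.card) :
    InjOn (cell A I) (I.powerset : Set (Finset (Fin n))) := by
  intro S hS T hT hST
  obtain ⟨x, hx⟩ := cell_nonempty A I S hcard hne hdim
  have hx' : x ∈ cell A I T := hST ▸ hx
  rw [Finset.mem_coe, Finset.mem_powerset] at hS hT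
  ext i
  by_cases hi : i ∈ I
  · exact (hx i hi).2.symm.trans (hx' i hi).2
  · exact ⟨fun h => absurd (hS h) hi, fun h => absurd (hT h) hi⟩

lemma setOf_isChamberOn_eq (A : Arrangement ℓ n) (I : Finset (Fin n)) (hcard : I.card ≤ ℓ)
    (hne : (⋂ i ∈ I, A.H i).Nonempty) (hdim : dimS (⋂ i ∈ I, A.H i) = ℓ - I.card) :
    {C | A.IsChamberOn (I : Set (Fin n)) C} = cell A I '' (I.powerset : Set (Finset (Fin n))) := by
  ext C
  constructor
  · rintro ⟨x, hx, rfl⟩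
    refine ⟨I.filter fun i => 0 < A.α i x,
      Finset.mem_coe.2 (Finset.mem_powerset.2 (Finset.filter_subset _ _)), ?_⟩
    refine (connectedComponentIn_compOn A I _ fun i hi => ⟨hx i hi, ?_⟩).symm
    simp [hi]
  · rintro ⟨S, -, rfl⟩
    obtain ⟨x, hx⟩ := cell_nonempty A I S hcard hne hdim
    exact ⟨x, cell_subset_compOn A I S hx, (connectedComponentIn_compOn A I S hx).symm⟩

/-- A generic flag subspace of dimension `|I| - 1` contains, for each `i ∈ I`, a point lying on all
the hyperplanes of `A(I)` except `H_i`. -/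
lemma exists_vertex (A : Arrangement ℓ n) (𝓕 : Flag ℓ) (hgen : GenericFlag A 𝓕)
    (I : Finset (Fin n)) (hcard : I.card ≤ ℓ) (hne : (⋂ i ∈ I, A.H i).Nonempty)
    (hdim : dimS (⋂ i ∈ I, A.H i) = ℓ - I.card) {i : Fin n} (hi : i ∈ I) :
    ∃ p ∈ 𝓕.F (I.card - 1), A.α i p ≠ 0 ∧ ∀ j ∈ I, j ≠ i → A.α j p = 0 := by
  have hpos : 0 < I.card := Finset.card_pos.2 ⟨i, hi⟩
  have hne' : (⋂ j ∈ I.erase i, A.H j).Nonempty := by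
    obtain ⟨x, hx⟩ := hne
    refine ⟨x, ?_⟩
    rw [mem_iInter_H] at hx ⊢
    exact fun j hj => hx j (Finset.mem_of_mem_erase hj)
  have hle := le_card_add_dimS A _ hne'
  rw [Finset.card_erase_of_mem hi] at hle
  obtain ⟨W, ⟨p, hp⟩, hW, -⟩ := (hgen _ (L_iInter A _ hne') (I.card - 1) (by omega)).1 hle
  rw [hW] at hp
  have hp' := (mem_iInter_H A _ p).1 hp.2
  refine ⟨p, hp.1, fun h₀ => ?_, fun j hj hji => hp' j (Finset.mem_erase.2 ⟨hji, hj⟩)⟩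
  have hempty := (hgen _ (L_iInter A I hne) (I.card - 1) (by omega)).2 (by omega)
  refine (Set.eq_empty_iff_forall_notMem.1 hempty) p ⟨hp.1, (mem_iInter_H A I p).2 fun j hj => ?_⟩
  by_cases hji : j = i
  · exact hji ▸ h₀
  · exact hp' j (Finset.mem_erase.2 ⟨hji, hj⟩)

lemma sum_mul_vertex (A : Arrangement ℓ n) (I : Finset (Fin n)) (p : Fin n → Fin ℓ → ℝ)
    (hp₀ : ∀ i ∈ I, ∀ j ∈ I, j ≠ i → A.α j (p i) = 0) (t : Fin n → ℝ) {j : Fin n} (hj : j ∈ I) :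
    ∑ i ∈ I, t i * A.α j (p i) = t j * A.α j (p j) :=
  Finset.sum_eq_single_of_mem j hj fun i hi hij => by rw [hp₀ i hi j hj hij.symm, mul_zero]

lemma affineIndependent_vertices (A : Arrangement ℓ n) (I : Finset (Fin n))
    (p : Fin n → Fin ℓ → ℝ) (hp : ∀ i ∈ I, A.α i (p i) ≠ 0)
    (hp₀ : ∀ i ∈ I, ∀ j ∈ I, j ≠ i → A.α j (p i) = 0) :
    AffineIndependent ℝ fun i : I => p i := by
  rw [affineIndependent_iff_of_fintype]
  intro w hw hsum j
  rw [Finset.weightedVSub_eq_linear_combination _ hw] at hsum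
  have h := affineForm_sum (A.α j) Finset.univ w fun i : I => p i
  rw [hsum, hw, map_zero, zero_mul, sub_zero, Finset.sum_eq_single_of_mem j (Finset.mem_univ j)
    fun i _ hij => by rw [hp₀ i i.2 j j.2 fun h => hij (Subtype.ext h.symm), mul_zero]] at h
  exact (mul_eq_zero.1 h.symm).resolve_right (hp j j.2)

lemma sum_div_eq_one (A : Arrangement ℓ n) (𝓕 : Flag ℓ) (hgen : GenericFlag A 𝓕)
    (I : Finset (Fin n)) (hcard : I.card ≤ ℓ) (hpos : 0 < I.card) (p : Fin n → Fin ℓ → ℝ)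
    (hpF : ∀ i ∈ I, p i ∈ 𝓕.F (I.card - 1)) (hp : ∀ i ∈ I, A.α i (p i) ≠ 0)
    (hp₀ : ∀ i ∈ I, ∀ j ∈ I, j ≠ i → A.α j (p i) = 0) {x : Fin ℓ → ℝ}
    (hx : x ∈ 𝓕.F (I.card - 1)) : ∑ i ∈ I, A.α i x / A.α i (p i) = 1 := by
  have hne : (⋂ i ∈ (∅ : Finset (Fin n)), A.H i).Nonempty := ⟨0, by simp⟩
  have hle := le_card_add_dimS A ∅ hne
  have heq := finrank_range_add_dimS A ∅ hne
  rw [Finset.card_empty] at hle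
  obtain ⟨W, -, hW, hWdim⟩ := (hgen _ (L_iInter A ∅ hne) (I.card - 1) (by omega)).1 (by omega)
  have hWF : (W : Set (Fin ℓ → ℝ)) = 𝓕.F (I.card - 1) := by simpa using hW
  have hspan : affineSpan ℝ (range fun i : I => p i) = W := by
    refine (affineIndependent_vertices A I p hp hp₀).affineSpan_eq_of_le_of_card_eq_finrank_add_one
      (affineSpan_le.2 ?_) ?_
    · rintro _ ⟨i, rfl⟩
      rw [hWF]
      exact hpF i i.2
    · rw [hWdim, Fintype.card_coe]
      omega
  let f : (Fin ℓ → ℝ) →ᵃ[ℝ] ℝ := ∑ i ∈ I, (A.α i (p i))⁻¹ • A.α i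
  have hf : ∀ y, f y = ∑ i ∈ I, A.α i y / A.α i (p i) := fun y => by
    let ev : ((Fin ℓ → ℝ) →ᵃ[ℝ] ℝ) →+ ℝ := ⟨⟨fun g => g y, rfl⟩, fun _ _ => rfl⟩
    have h : f y = ∑ i ∈ I, (A.α i (p i))⁻¹ * A.α i y := map_sum ev _ I
    simpa only [div_eq_inv_mul] using h
  have hxW : x ∈ affineSpan ℝ (range fun i : I => p i) := by
    rw [hspan, ← SetLike.mem_coe, hWF]
    exact hx
  have hsub : affineSpan ℝ (range fun i : I => p i) ≤ (AffineSubspace.mk' (1 : ℝ) ⊥).comap f := by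
    rw [affineSpan_le]
    rintro _ ⟨⟨j, hj⟩, rfl⟩
    have : f (p j) = 1 := by
      rw [hf, Finset.sum_eq_single_of_mem j hj fun i hi hij => by
        rw [hp₀ j hj i hi hij, zero_div], div_self (hp j hj)]
    simp [this]
  have := hsub hxW
  rw [AffineSubspace.mem_comap, AffineSubspace.mem_mk', Submodule.mem_bot, vsub_eq_sub,
    sub_eq_zero, hf] at this
  exact this

/-- There are weights with prescribed signs and sum one as soon as one sign is positive. -/
lemma exists_weights {ι : Type*} [DecidableEq ι] (I P : Finset ι) (hP : P ⊆ I)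
    (hne : P.Nonempty) :
    ∃ t : ι → ℝ, ∑ i ∈ I, t i = 1 ∧ (∀ i ∈ P, 0 < t i) ∧ ∀ i ∈ I, i ∉ P → t i < 0 := by
  have hc : (0 : ℝ) < P.card := by exact_mod_cast hne.card_pos
  refine ⟨fun i => if i ∈ P then (1 + (I \ P).card) / P.card else -1, ?_, ?_, ?_⟩
  · rw [← Finset.sum_sdiff hP, Finset.sum_congr rfl fun i hi => if_neg (Finset.mem_sdiff.1 hi).2,
      Finset.sum_congr (s₁ := P) rfl fun i hi => if_pos hi]
    simp only [Finset.sum_const, nsmul_eq_mul]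
    field_simp
    ring
  · intro i hi
    simp only [hi, if_true]
    positivity
  · intro i _ hi
    simp [hi]

/-- A sign pattern agreeing somewhere with the vertex signs is realised in the flag subspace. -/
lemma cell_inter_F_nonempty (A : Arrangement ℓ n) (𝓕 : Flag ℓ) (q : ℕ) (I S : Finset (Fin n))
    (p : Fin n → Fin ℓ → ℝ) (hpF : ∀ i ∈ I, p i ∈ 𝓕.F q) (hp : ∀ i ∈ I, A.α i (p i) ≠ 0)
    (hp₀ : ∀ i ∈ I, ∀ j ∈ I, j ≠ i → A.α j (p i) = 0) {j : Fin n} (hj : j ∈ I)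
    (hjS : j ∈ S ↔ 0 < A.α j (p j)) : (cell A I S ∩ 𝓕.F q).Nonempty := by
  obtain ⟨t, ht, htpos, htneg⟩ := exists_weights I
    (I.filter fun i => (i ∈ S ↔ 0 < A.α i (p i))) (Finset.filter_subset _ _)
    ⟨j, Finset.mem_filter.2 ⟨hj, hjS⟩⟩
  refine ⟨∑ i ∈ I, t i • p i, fun i hi => ?_, fun k hk => ?_⟩
  · rw [affineForm_affineComb _ _ _ _ ht, sum_mul_vertex A I p hp₀ t hi]
    have hpos := htpos i
    have hneg := htneg i hi
    simp only [Finset.mem_filter, hi, true_and] at hpos hneg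
    rcases lt_or_gt_of_ne (hp i hi) with h | h <;> by_cases hS : i ∈ S
    · have h₁ := mul_pos_of_neg_of_neg (hneg (by simp [hS, h.le])) h
      exact ⟨h₁.ne', by simp [hS, h₁]⟩
    · have h₁ := mul_neg_of_pos_of_neg (hpos (by simp [hS, h.le])) h
      exact ⟨h₁.ne, by simp [hS, h₁.le]⟩
    · have h₁ := mul_pos (hpos (by simp [hS, h])) h
      exact ⟨h₁.ne', by simp [hS, h₁]⟩
    · have h₁ := mul_neg_of_neg_of_pos (hneg (by simp [hS, h])) h
      exact ⟨h₁.ne, by simp [hS, h₁.le]⟩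
  · rw [affineForm_affineComb _ _ _ _ ht]
    exact Finset.sum_eq_zero fun i hi => by rw [hpF i hi k hk, mul_zero]

lemma cell_inter_F_eq_empty_iff (A : Arrangement ℓ n) (𝓕 : Flag ℓ) (hgen : GenericFlag A 𝓕)
    (I S : Finset (Fin n)) (hS : S ⊆ I) (hcard : I.card ≤ ℓ) (hpos : 0 < I.card)
    (p : Fin n → Fin ℓ → ℝ) (hpF : ∀ i ∈ I, p i ∈ 𝓕.F (I.card - 1))
    (hp : ∀ i ∈ I, A.α i (p i) ≠ 0) (hp₀ : ∀ i ∈ I, ∀ j ∈ I, j ≠ i → A.α j (p i) = 0) :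
    cell A I S ∩ 𝓕.F (I.card - 1) = ∅ ↔ S = I.filter fun i => A.α i (p i) < 0 := by
  constructor
  · intro hempty
    ext i
    rw [Finset.mem_filter]
    by_cases hi : i ∈ I
    · have h : ¬(i ∈ S ↔ 0 < A.α i (p i)) := fun h =>
        (cell_inter_F_nonempty A 𝓕 _ I S p hpF hp hp₀ hi h).ne_empty hempty
      rcases lt_or_gt_of_ne (hp i hi) with h' | h'
      · simp only [h'.not_gt, iff_false, not_not] at h
        simp [h, hi, h']
      · simp only [h', iff_true] at h
        simp [h, h'.le]
    · exact ⟨fun h => absurd (hS h) hi, fun h => absurd h.1 hi⟩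
  · rintro rfl
    rw [Set.eq_empty_iff_forall_notMem]
    rintro x ⟨hxc, hxF⟩
    have h := sum_div_eq_one A 𝓕 hgen I hcard hpos p hpF hp hp₀ hxF
    have hle : ∑ i ∈ I, A.α i x / A.α i (p i) ≤ 0 := Finset.sum_nonpos fun i hi => by
      have hx := (hxc i hi).2
      simp only [Finset.mem_filter, hi, true_and] at hx
      rcases lt_or_gt_of_ne (hp i hi) with h' | h'
      · exact div_nonpos_of_nonneg_of_nonpos (hx.2 h').le h'.le
      · exact div_nonpos_of_nonpos_of_nonneg (not_lt.1 fun h₀ => h'.not_gt (hx.1 h₀)) h'.le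
    linarith

end

/-- If the hyperplanes indexed by `I` are independent
(`X(I) = ⋂_{i ∈ I} H_i` nonempty of dimension `ℓ - |I|`), then the
subarrangement `A(I)` has exactly `2^|I|` chambers, and exactly one of them
avoids `F^{|I| - 1}`. -/
theorem subarrangement_chambers (ℓ n : ℕ) (A : Arrangement ℓ n) (𝓕 : Flag ℓ)
    (hind : LinearIndependent ℝ fun j : Fin ℓ => (𝓕.h j).linear)
    (hgen : GenericFlag A 𝓕)
    (I : Finset (Fin n))
    (h1I : Cond1On A (I : Set (Fin n)) 𝓕) (h2I : Cond2On A (I : Set (Fin n)) 𝓕)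
    (hcard : I.card ≤ ℓ)
    (hne : (⋂ i ∈ I, A.H i).Nonempty)
    (hdim : dimS (⋂ i ∈ I, A.H i) = ℓ - I.card) :
    {C : Set (Fin ℓ → ℝ) | A.IsChamberOn (I : Set (Fin n)) C}.ncard = 2 ^ I.card ∧
    ∃! C₀ : Set (Fin ℓ → ℝ), A.IsChamberOn (I : Set (Fin n)) C₀ ∧
      (I.card = 0 ∨ C₀ ∩ 𝓕.F (I.card - 1) = ∅) := by
  have hset := setOf_isChamberOn_eq A I hcard hne hdim
  have hcell : ∀ S ⊆ I, A.IsChamberOn (I : Set (Fin n)) (cell A I S) := fun S hS =>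
    hset.ge ⟨S, by simpa using hS, rfl⟩
  have hform : ∀ C, A.IsChamberOn (I : Set (Fin n)) C → ∃ S ⊆ I, cell A I S = C := fun C hC => by
    obtain ⟨S, hS, h⟩ := hset.le hC
    exact ⟨S, by simpa using hS, h⟩
  refine ⟨?_, ?_⟩
  · rw [hset, (cell_injOn A I hcard hne hdim).ncard_image, Set.ncard_coe_finset,
      Finset.card_powerset]
  rcases Nat.eq_zero_or_pos I.card with h₀ | hpos
  · refine ⟨cell A I ∅, ⟨hcell _ (Finset.empty_subset _), Or.inl h₀⟩, ?_⟩
    rintro C ⟨hC, -⟩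
    obtain ⟨S, hS, rfl⟩ := hform C hC
    rw [Finset.card_eq_zero.1 h₀, Finset.subset_empty] at hS
    rw [hS]
  · have hex : ∀ i, ∃ p, i ∈ I → p ∈ 𝓕.F (I.card - 1) ∧ A.α i p ≠ 0 ∧
        ∀ j ∈ I, j ≠ i → A.α j p = 0 := fun i => by
      by_cases hi : i ∈ I
      · obtain ⟨p, h⟩ := exists_vertex A 𝓕 hgen I hcard hne hdim hi
        exact ⟨p, fun _ => h⟩
      · exact ⟨0, fun h => absurd h hi⟩
    choose p hp using hex
    have hiff := fun S hS => cell_inter_F_eq_empty_iff A 𝓕 hgen I S hS hcard hpos p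
      (fun i hi => (hp i hi).1) (fun i hi => (hp i hi).2.1) fun i hi => (hp i hi).2.2
    refine ⟨cell A I (I.filter fun i => A.α i (p i) < 0),
      ⟨hcell _ (Finset.filter_subset _ _), Or.inr ((hiff _ (Finset.filter_subset _ _)).2 rfl)⟩, ?_⟩
    rintro C ⟨hC, hCF⟩
    obtain ⟨S, hS, rfl⟩ := hform C hC
    rw [(hiff S hS).1 (hCF.resolve_left hpos.ne')]

end IY
end

section
/- Let I = {i_1, …, i_q} ⊆ {1, …, n} with H_{i_1}, …, H_{i_q} ∈ A independent (X(I) = H_{i_1} ∩ ⋯ ∩ H_{i_q} nonempty of dimension ℓ − q), and let C_0(I) be the unique chamber of A(I) = {H_{i_1}, …, H_{i_q}} with C_0(I) ∩ F^{q−1} = ∅. Define S(I) = {x + iv ∈ ℂ^ℓ : x ∈ C_0(I), v ∈ τ(X(I))}. Then the closure of S(I) in M(A) (i.e. M(A) intersected with the closure of S(I) in ℂ^ℓ) is the union of the closures in M(A) of the sets S(C), taken over all C ∈ ch^q_F(A) with C ⊆ C_0(I) and τ(X_C) = τ(X(I)), and these closures are pairwise disjoint. -/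
open Set

namespace IY
open Arrangement

open Filter Topology

section AffineForms

variable {E : Type*} [AddCommGroup E] [Module ℝ E]

theorem affine_lineMap (f : E →ᵃ[ℝ] ℝ) (p y : E) (t : ℝ) :
    f (AffineMap.lineMap p y t) = f p + t * (f y - f p) := by
  rw [AffineMap.apply_lineMap, AffineMap.lineMap_apply]
  simp only [vsub_eq_sub, smul_eq_mul, vadd_eq_add]
  ring

theorem eventually_affine_lineMap_pos (f : E →ᵃ[ℝ] ℝ) (p y : E) {a : ℝ}
    (h : 0 < a * f p ∨ f p = 0 ∧ 0 < a * f y) :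
    ∀ᶠ t : ℝ in 𝓝[>] 0, 0 < a * f (AffineMap.lineMap p y t) := by
  simp only [affine_lineMap]
  rcases h with h | ⟨h0, h⟩
  · have hc : Tendsto (fun t : ℝ => a * (f p + t * (f y - f p))) (𝓝 0)
        (𝓝 (a * (f p + 0 * (f y - f p)))) := Continuous.tendsto (by fun_prop) 0
    exact (hc.eventually_const_lt (by simpa using h)).filter_mono nhdsWithin_le_nhds
  · filter_upwards [self_mem_nhdsWithin] with t ht
    rw [h0]
    have := mul_pos (Set.mem_Ioi.1 ht) h
    nlinarith

theorem eventually_affine_lineMap_ne_zero (f : E →ᵃ[ℝ] ℝ) (p y : E) (h : f p ≠ 0 ∨ f y ≠ 0) :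
    ∀ᶠ t : ℝ in 𝓝[>] 0, f (AffineMap.lineMap p y t) ≠ 0 := by
  by_cases hp : f p = 0
  · have hy : f y ≠ 0 := h.resolve_left (not_not.2 hp)
    filter_upwards [eventually_affine_lineMap_pos f p y (a := f y)
      (Or.inr ⟨hp, mul_self_pos.2 hy⟩)] with t ht h0
    simp [h0] at ht
  · filter_upwards [eventually_affine_lineMap_pos f p y (a := f p)
      (Or.inl (mul_self_pos.2 hp))] with t ht h0
    simp [h0] at ht

/-- Finitely many affine forms, none vanishing identically on an affine subspace, have a common
point of nonvanishing there. -/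
theorem exists_mem_forall_affine_ne_zero {ι : Type*} (s : Finset ι) (f : ι → E →ᵃ[ℝ] ℝ)
    (W : AffineSubspace ℝ E) (hW : (W : Set E).Nonempty)
    (h : ∀ i ∈ s, ∃ y ∈ W, f i y ≠ 0) : ∃ g ∈ W, ∀ i ∈ s, f i g ≠ 0 := by
  classical
  induction s using Finset.induction_on with
  | empty => exact ⟨hW.some, hW.some_mem, by simp⟩
  | insert a s _ ih =>
    obtain ⟨g, hg, hgs⟩ := ih fun i hi => h i (Finset.mem_insert_of_mem hi)
    obtain ⟨y, hy, hya⟩ := h a (Finset.mem_insert_self a s)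
    have h1 : ∀ᶠ t : ℝ in 𝓝[>] 0, ∀ i ∈ s, f i (AffineMap.lineMap g y t) ≠ 0 :=
      (Finset.eventually_all s).2 fun i hi =>
        eventually_affine_lineMap_ne_zero _ _ _ (Or.inl (hgs i hi))
    obtain ⟨t, ht, hta⟩ := (h1.and (eventually_affine_lineMap_ne_zero (f a) g y (Or.inr hya))).exists
    refine ⟨_, AffineMap.lineMap_mem t hg hy, fun i hi => ?_⟩
    rcases Finset.mem_insert.1 hi with rfl | hi
    · exact hta
    · exact ht i hi

end AffineForms

section Chambers

variable {ℓ n : ℕ} (A : Arrangement ℓ n)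

theorem Arrangement.continuous_α (i : Fin n) : Continuous (A.α i) :=
  (A.α i).continuous_of_finiteDimensional

/-- The points on the same side as `x` of every hyperplane indexed by `s`. -/
def Arrangement.side (s : Set (Fin n)) (x : Fin ℓ → ℝ) : Set (Fin ℓ → ℝ) :=
  {y | ∀ i ∈ s, 0 < A.α i x * A.α i y}

variable {A}

theorem mul_pos_trans {a b c : ℝ} (hab : 0 < a * b) (hbc : 0 < b * c) : 0 < a * c := by
  have hb : b ≠ 0 := by rintro rfl; simp at hab
  have : 0 < b * b * (a * c) := by nlinarith [mul_pos hab hbc]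
  exact pos_of_mul_pos_right this (mul_self_nonneg b)

theorem side_eq_of_mem {s : Set (Fin n)} {x y : Fin ℓ → ℝ} (h : y ∈ A.side s x) :
    A.side s y = A.side s x := by
  ext z
  exact ⟨fun hz i hi => mul_pos_trans (h i hi) (hz i hi),
    fun hz i hi => mul_pos_trans (by simpa [mul_comm] using h i hi) (hz i hi)⟩

theorem mem_side_self {s : Set (Fin n)} {x : Fin ℓ → ℝ} (h : x ∈ A.compOn s) : x ∈ A.side s x :=
  fun i hi => mul_self_pos.2 (h i hi)

theorem convex_side (s : Set (Fin n)) (x : Fin ℓ → ℝ) : Convex ℝ (A.side s x) := by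
  intro y hy z hz a b ha hb hab i hi
  rw [Convex.combo_affine_apply hab, smul_eq_mul, smul_eq_mul]
  have h1 := mul_nonneg ha (hy i hi).le
  have h2 := mul_nonneg hb (hz i hi).le
  rcases ha.eq_or_lt with rfl | ha
  · obtain rfl : b = 1 := by linarith
    simpa using hz i hi
  · have := mul_pos ha (hy i hi)
    linarith

theorem connectedComponentIn_compOn_s16 {s : Set (Fin n)} {x : Fin ℓ → ℝ} (hx : x ∈ A.compOn s) :
    connectedComponentIn (A.compOn s) x = A.side s x := by
  apply Subset.antisymm
  · intro y hy i hi
    by_contra hneg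
    have hpre := isPreconnected_connectedComponentIn (F := A.compOn s) (x := x)
    have hc : ContinuousOn (fun y => A.α i x * A.α i y) (connectedComponentIn (A.compOn s) x) :=
      (continuous_const.mul (A.continuous_α i)).continuousOn
    obtain ⟨z, hz, hz0⟩ := hpre.intermediate_value hy (mem_connectedComponentIn hx) hc
      ⟨not_lt.1 hneg, mul_self_nonneg (A.α i x)⟩
    exact mul_ne_zero (hx i hi) (connectedComponentIn_subset _ _ hz i hi) hz0
  · refine (convex_side s x).isPreconnected.subset_connectedComponentIn (mem_side_self hx) ?_
    intro y hy i hi h0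
    simpa [h0] using hy i hi

theorem Arrangement.IsChamberOn.eq_side {s : Set (Fin n)} {C : Set (Fin ℓ → ℝ)}
    (hC : A.IsChamberOn s C) {c : Fin ℓ → ℝ} (hc : c ∈ C) : C = A.side s c := by
  obtain ⟨x, hx, rfl⟩ := hC
  rw [connectedComponentIn_compOn_s16 hx] at hc ⊢
  exact (side_eq_of_mem hc).symm

theorem isChamberOn_side {s : Set (Fin n)} {x : Fin ℓ → ℝ} (hx : x ∈ A.compOn s) :
    A.IsChamberOn s (A.side s x) :=
  ⟨x, hx, (connectedComponentIn_compOn_s16 hx).symm⟩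

theorem Arrangement.IsChamberOn.subset_compOn {s : Set (Fin n)} {C : Set (Fin ℓ → ℝ)}
    (hC : A.IsChamberOn s C) : C ⊆ A.compOn s := by
  obtain ⟨x, _, rfl⟩ := hC
  exact connectedComponentIn_subset _ _

variable (A) in
theorem finite_setOf_isChamber : {C | A.IsChamber C}.Finite := by
  refine (Set.finite_range fun t : Set (Fin n) =>
    {y | ∀ i, (i ∈ t → 0 < A.α i y) ∧ (i ∉ t → A.α i y < 0)}).subset ?_
  rintro _ ⟨x, hx, rfl⟩
  refine ⟨{i | 0 < A.α i x}, ?_⟩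
  rw [connectedComponentIn_compOn_s16 hx]
  ext y
  refine ⟨fun h i hi => ?_, fun h i => ⟨fun hi => ?_, fun hi => ?_⟩⟩
  · rcases lt_or_gt_of_ne (hx i hi) with h' | h'
    · exact mul_pos_of_neg_of_neg h' ((h i).2 (not_lt.2 h'.le))
    · exact mul_pos h' ((h i).1 h')
  · exact pos_of_mul_pos_right (h i trivial) (le_of_lt hi)
  · exact neg_of_mul_pos_right (h i trivial) (not_lt.1 hi)

theorem mul_nonneg_of_mem_closure {s : Set (Fin n)} {c p : Fin ℓ → ℝ}
    (hp : p ∈ closure (A.side s c)) {i : Fin n} (hi : i ∈ s) : 0 ≤ A.α i c * A.α i p := by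
  have hcl : IsClosed {y | 0 ≤ A.α i c * A.α i y} :=
    isClosed_le continuous_const (continuous_const.mul (A.continuous_α i))
  exact closure_minimal (fun y hy => (hy i hi).le) hcl hp

theorem sepPt_iff {p x : Fin ℓ → ℝ} {i : Fin n} : SepPt A p x i ↔ A.α i p * A.α i x ≤ 0 := by
  have himg : (A.α i) '' segment ℝ p x = segment ℝ (A.α i p) (A.α i x) :=
    image_segment ℝ (A.α i) p x
  have h : SepPt A p x i ↔ (0 : ℝ) ∈ segment ℝ (A.α i p) (A.α i x) := by
    rw [← himg]; rfl
  rw [h, segment_eq_uIcc, Set.mem_uIcc, mul_nonpos_iff]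
  tauto

end Chambers

section Flats

variable {ℓ n : ℕ} (A : Arrangement ℓ n)

/-- The intersection of the hyperplanes indexed by `t`, as an affine subspace. -/
def Arrangement.flat (t : Set (Fin n)) : AffineSubspace ℝ (Fin ℓ → ℝ) where
  carrier := ⋂ i ∈ t, A.H i
  smul_vsub_vadd_mem' := by
    intro c p₁ p₂ p₃ h₁ h₂ h₃
    simp only [Arrangement.H, Set.mem_iInter, Set.mem_ofPred_eq] at h₁ h₂ h₃ ⊢
    intro i hi
    rw [AffineMap.map_vadd, h₃ i hi, map_smul, AffineMap.linearMap_vsub, h₁ i hi, h₂ i hi]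
    simp

variable {A}

theorem tau_eq_direction (W : AffineSubspace ℝ (Fin ℓ → ℝ)) :
    tau (W : Set (Fin ℓ → ℝ)) = W.direction := by
  rw [tau, AffineSubspace.affineSpan_coe]

theorem mem_tau_iInter {t : Set (Fin n)} {p : Fin ℓ → ℝ} (hp : p ∈ ⋂ i ∈ t, A.H i)
    {v : Fin ℓ → ℝ} : v ∈ tau (⋂ i ∈ t, A.H i) ↔ ∀ i ∈ t, (A.α i).linear v = 0 := by
  change v ∈ tau (A.flat t : Set (Fin ℓ → ℝ)) ↔ _
  rw [tau_eq_direction, ← AffineSubspace.vadd_mem_iff_mem_direction v (p := p) hp]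
  change v +ᵥ p ∈ ⋂ i ∈ t, A.H i ↔ _
  simp only [Arrangement.H, Set.mem_iInter, Set.mem_ofPred_eq] at hp ⊢
  refine forall₂_congr fun i hi => ?_
  rw [AffineMap.map_vadd, hp i hi]
  simp

theorem L_iInter_s16 {t : Set (Fin n)} {p : Fin ℓ → ℝ} (hp : p ∈ ⋂ i ∈ t, A.H i) :
    A.L (⋂ i ∈ t, A.H i) :=
  ⟨⟨p, hp⟩, t, Set.subset_univ t, rfl⟩

theorem dimS_iInter_singleton_lt (i : Fin n) : dimS (⋂ j ∈ ({i} : Set (Fin n)), A.H j) < ℓ := by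
  rcases Set.eq_empty_or_nonempty (⋂ j ∈ ({i} : Set (Fin n)), A.H j) with h | ⟨p, hp⟩
  · rw [h, dimS, AffineSubspace.span_empty, AffineSubspace.direction_bot, finrank_bot]
    rcases Nat.eq_zero_or_pos ℓ with rfl | hℓ
    · exact (A.nonzero i (Subsingleton.elim _ _)).elim
    · exact hℓ
  · have hlt : tau (⋂ j ∈ ({i} : Set (Fin n)), A.H j) < ⊤ := by
      rw [lt_top_iff_ne_top]
      intro htop
      apply A.nonzero i
      refine LinearMap.ext fun v => ?_
      exact (mem_tau_iInter hp).1 (htop ▸ Submodule.mem_top) i rfl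
    have h := Submodule.finrank_lt_finrank_of_lt hlt
    rwa [finrank_top, Module.finrank_fin_fun] at h

end Flats

section GenericFlags

variable {ℓ n : ℕ} {A : Arrangement ℓ n} {𝓕 : Flag ℓ} {q : ℕ}

theorem exists_affineSubspace_eq_F (hgen : GenericFlag A 𝓕) (hq : q ≤ ℓ) :
    ∃ W : AffineSubspace ℝ (Fin ℓ → ℝ), (W : Set (Fin ℓ → ℝ)).Nonempty ∧
      (W : Set (Fin ℓ → ℝ)) = 𝓕.F q ∧ Module.finrank ℝ W.direction = q := by
  have hL : A.L Set.univ := ⟨Set.univ_nonempty, ∅, Set.empty_subset _, by simp⟩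
  have hdim : dimS (Set.univ : Set (Fin ℓ → ℝ)) = ℓ := by
    rw [dimS, AffineSubspace.span_univ, AffineSubspace.direction_top, finrank_top,
      Module.finrank_fin_fun]
  obtain ⟨W, hne, hW, hfr⟩ := (hgen _ hL q hq).1 (by omega)
  exact ⟨W, hne, by simpa using hW, by omega⟩

theorem le_add_dimS (hgen : GenericFlag A 𝓕) (hq : q ≤ ℓ) {X : Set (Fin ℓ → ℝ)} (hX : A.L X)
    {p : Fin ℓ → ℝ} (hpX : p ∈ X) (hpF : p ∈ 𝓕.F q) : ℓ ≤ q + dimS X := by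
  by_contra h
  have := (hgen X hX q hq).2 (not_le.1 h)
  exact (this ▸ (⟨hpF, hpX⟩ : p ∈ 𝓕.F q ∩ X) : p ∈ (∅ : Set _))

theorem lineMap_mem_F {p y : Fin ℓ → ℝ} (hp : p ∈ 𝓕.F q) (hy : y ∈ 𝓕.F q) (t : ℝ) :
    AffineMap.lineMap p y t ∈ 𝓕.F q := by
  intro j hj
  rw [affine_lineMap, hp j hj, hy j hj]
  ring

/-- The flag space `F^q` contains a point off all hyperplanes. -/
theorem exists_mem_F_forall_ne_zero (hgen : GenericFlag A 𝓕) (hq : q ≤ ℓ) :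
    ∃ g ∈ 𝓕.F q, ∀ i, A.α i g ≠ 0 := by
  obtain ⟨W, hne, hW, hfr⟩ := exists_affineSubspace_eq_F hgen hq
  obtain ⟨g, hg, h⟩ := exists_mem_forall_affine_ne_zero Finset.univ A.α W hne (by
    intro i _
    by_contra! h
    obtain ⟨p, hp⟩ := hne
    have hWX : 𝓕.F q ⊆ ⋂ j ∈ ({i} : Set (Fin n)), A.H j := by
      intro y hy
      simpa [Arrangement.H] using h y (by rw [← hW] at hy; exact hy)
    have hpF : p ∈ 𝓕.F q := hW ▸ hp
    have hL := L_iInter_s16 (hWX hpF)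
    have hle := le_add_dimS hgen hq hL (hWX hpF) hpF
    obtain ⟨W', -, hW', hfr'⟩ := (hgen _ hL q hq).1 hle
    rw [Set.inter_eq_left.2 hWX, ← hW] at hW'
    have hlt := dimS_iInter_singleton_lt (A := A) i
    rw [SetLike.coe_injective hW', hfr] at hfr'
    omega)
  exact ⟨g, hW ▸ hg, fun i => h i (Finset.mem_univ i)⟩

/-- A flat of dimension `ℓ - q` is transversal to `F^q`. -/
theorem exists_mem_F_sub_mem_tau (hgen : GenericFlag A 𝓕) (hq : q ≤ ℓ) {t : Set (Fin n)}
    (hne : (⋂ i ∈ t, A.H i).Nonempty) (hdim : dimS (⋂ i ∈ t, A.H i) = ℓ - q) (x : Fin ℓ → ℝ) :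
    ∃ y ∈ 𝓕.F q, x - y ∈ tau (⋂ i ∈ t, A.H i) := by
  obtain ⟨W, ⟨f, hf⟩, hW, hfr⟩ := exists_affineSubspace_eq_F hgen hq
  obtain ⟨W', ⟨p, hp⟩, hW', hfr'⟩ := (hgen _ (L_iInter_s16 hne.some_mem) q hq).1 (by omega)
  have hinf : W' = W ⊓ A.flat t := by
    apply SetLike.coe_injective
    rw [hW', ← hW]
    rfl
  have hpW : p ∈ W ⊓ A.flat t := hinf ▸ hp
  have hdir : W'.direction = W.direction ⊓ tau (⋂ i ∈ t, A.H i) := by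
    rw [hinf, AffineSubspace.direction_inf_of_mem_inf hpW, ← tau_eq_direction (A.flat t)]
    rfl
  have hsum := Submodule.finrank_sup_add_finrank_inf_eq W.direction (tau (⋂ i ∈ t, A.H i))
  rw [← hdir, hfr', hfr] at hsum
  have hT : Module.finrank ℝ (tau (⋂ i ∈ t, A.H i)) = ℓ - q := hdim
  have htop : W.direction ⊔ tau (⋂ i ∈ t, A.H i) = ⊤ := by
    apply Submodule.eq_top_of_finrank_eq
    rw [Module.finrank_fin_fun]
    omega
  obtain ⟨a, ha, b, hb, hab⟩ := Submodule.mem_sup.1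
    (htop ▸ Submodule.mem_top : x - f ∈ W.direction ⊔ tau (⋂ i ∈ t, A.H i))
  refine ⟨a +ᵥ f, hW ▸ AffineSubspace.vadd_mem_of_mem_direction ha hf, ?_⟩
  have : x - (a +ᵥ f) = b := by
    rw [vadd_eq_add, sub_add_eq_sub_sub_swap, ← hab, add_sub_cancel_left]
  rwa [this]

theorem tau_le_ker_of_apply_eq_zero (hgen : GenericFlag A 𝓕) (hq : q ≤ ℓ)
    {X : Set (Fin ℓ → ℝ)} (hX : A.L X) (hdim : dimS X = ℓ - q) {p : Fin ℓ → ℝ}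
    (hpX : p ∈ X) (hpF : p ∈ 𝓕.F q) {i : Fin n} (hi : A.α i p = 0) : i ∈ parIdx A X := by
  obtain ⟨-, t, -, rfl⟩ := hX
  have hp' : p ∈ ⋂ j ∈ insert i t, A.H j := by
    rw [Set.biInter_insert]
    exact ⟨hi, hpX⟩
  have hle : tau (⋂ j ∈ insert i t, A.H j) ≤ tau (⋂ j ∈ t, A.H j) := fun v hv =>
    (mem_tau_iInter hpX).2 fun j hj => (mem_tau_iInter hp').1 hv j (Set.mem_insert_of_mem i hj)
  have hdim' := le_add_dimS hgen hq (L_iInter_s16 hp') hp' hpF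
  have heq := Submodule.eq_of_le_of_finrank_le hle (by
    change dimS _ ≤ dimS _
    omega)
  intro v hv
  rw [← heq] at hv
  exact (mem_tau_iInter hp').1 hv i (Set.mem_insert i t)

/-- Inside `F^q`, near the minimum point `p` of `h_q` on `C`, the chamber `C` is cut out by the
hyperplanes parallel to `X_C` alone. -/
theorem eventually_lineMap_mem_chamber (hgen : GenericFlag A 𝓕) (hq : q ≤ ℓ)
    {C X : Set (Fin ℓ → ℝ)} (hC : A.IsChamber C) (hX : A.L X) (hdim : dimS X = ℓ - q)
    {p c y : Fin ℓ → ℝ} (hpX : p ∈ X) (hpF : p ∈ 𝓕.F q) (hpC : p ∈ closure (C ∩ 𝓕.F q))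
    (hc : c ∈ C) (hy : y ∈ A.side (parIdx A X) c) :
    ∀ᶠ t : ℝ in 𝓝[>] 0, AffineMap.lineMap p y t ∈ C := by
  have hCc := hC.eq_side hc
  have hpC' : p ∈ closure (A.side Set.univ c) := hCc ▸ closure_mono Set.inter_subset_left hpC
  have hne : ∀ i, A.α i c ≠ 0 := fun i => hC.subset_compOn hc i trivial
  rw [hCc]
  have : ∀ᶠ t : ℝ in 𝓝[>] 0, ∀ i, 0 < A.α i c * A.α i (AffineMap.lineMap p y t) := by
    refine eventually_all.2 fun i => eventually_affine_lineMap_pos _ _ _ ?_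
    by_cases hi : A.α i p = 0
    · exact Or.inr ⟨hi, hy i (tau_le_ker_of_apply_eq_zero hgen hq hX hdim hpX hpF hi)⟩
    · exact Or.inl ((mul_nonneg_of_mem_closure hpC' (Set.mem_univ i)).lt_of_ne'
        (mul_ne_zero (hne i) hi))
  filter_upwards [this] with t ht i _ using ht i

theorem le_of_eventually_le_affine_lineMap {E : Type*} [AddCommGroup E] [Module ℝ E]
    (f : E →ᵃ[ℝ] ℝ) (y g : E) {a : ℝ}
    (h : ∀ᶠ t : ℝ in 𝓝[>] 0, a ≤ f (AffineMap.lineMap y g t)) : a ≤ f y := by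
  simp only [affine_lineMap] at h
  have hc : Tendsto (fun t : ℝ => f y + t * (f g - f y)) (𝓝[>] 0)
      (𝓝 (f y + 0 * (f g - f y))) :=
    (Continuous.tendsto (by fun_prop) 0).mono_left nhdsWithin_le_nhds
  simpa using ge_of_tendsto hc h

theorem affine_le_of_eventually_le_lineMap {E : Type*} [AddCommGroup E] [Module ℝ E]
    (f : E →ᵃ[ℝ] ℝ) (p y : E)
    (h : ∀ᶠ t : ℝ in 𝓝[>] 0, f p ≤ f (AffineMap.lineMap p y t)) : f p ≤ f y := by
  obtain ⟨t, ht, ht0⟩ := (h.and self_mem_nhdsWithin).exists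
  rw [affine_lineMap] at ht
  have := nonneg_of_mul_nonneg_right (by linarith : 0 ≤ t * (f y - f p)) ht0
  linarith

theorem hq_le_of_mem_side (hgen : GenericFlag A 𝓕) (hq : q ≤ ℓ)
    {C X : Set (Fin ℓ → ℝ)} (hC : A.IsChamber C) (hX : A.L X) (hdim : dimS X = ℓ - q)
    {p c y : Fin ℓ → ℝ} (hpX : p ∈ X) (hpF : p ∈ 𝓕.F q) (hpC : p ∈ closure (C ∩ 𝓕.F q))
    (hmin : ∀ y ∈ closure (C ∩ 𝓕.F q), 𝓕.hq q p ≤ 𝓕.hq q y)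
    (hc : c ∈ C) (hyF : y ∈ 𝓕.F q) (hy : y ∈ A.side (parIdx A X) c) :
    𝓕.hq q p ≤ 𝓕.hq q y := by
  refine affine_le_of_eventually_le_lineMap _ _ _ ?_
  filter_upwards [eventually_lineMap_mem_chamber hgen hq hC hX hdim hpX hpF hpC hc hy] with t ht
  exact hmin _ (subset_closure ⟨ht, lineMap_mem_F hpF hyF t⟩)

/-- A chamber in `ch^q_F` is determined by `τ(X_C)` and the chamber of the hyperplanes parallel
to `X_C` containing it. -/
theorem chamber_eq_of_same_side (hgen : GenericFlag A 𝓕) (h2 : Cond2On A Set.univ 𝓕)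
    (hq : q ≤ ℓ) {C C' X X' : Set (Fin ℓ → ℝ)}
    (hC : A.IsChamber C) (hC' : A.IsChamber C') (hX : IsXC A 𝓕 q C X) (hX' : IsXC A 𝓕 q C' X')
    (htau : tau X = tau X') {c c' : Fin ℓ → ℝ} (hc : c ∈ C) (hc' : c' ∈ C')
    (hcF : c ∈ 𝓕.F q) (hcF' : c' ∈ 𝓕.F q) (hside : c' ∈ A.side (parIdx A X) c) : C = C' := by
  obtain ⟨hL, hdim, p, hXp, hpC, hmin⟩ := hX
  obtain ⟨hL', hdim', p', hXp', hpC', hmin'⟩ := hX'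
  obtain ⟨hpX, hpF⟩ : p ∈ X ∩ 𝓕.F q := hXp ▸ rfl
  obtain ⟨hpX', hpF'⟩ : p' ∈ X' ∩ 𝓕.F q := hXp' ▸ rfl
  have hpar : parIdx A X' = parIdx A X := by simp only [parIdx, htau]
  have hside' : A.side (parIdx A X') c' = A.side (parIdx A X) c := by
    rw [hpar, side_eq_of_mem hside]
  have hsub : ∀ y ∈ C, y ∈ A.side (parIdx A X) c := fun y hy i _ =>
    (hC.eq_side hc ▸ hy : y ∈ A.side Set.univ c) i trivial
  have hsub' : ∀ y ∈ C', y ∈ A.side (parIdx A X) c := fun y hy => by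
    rw [← hside']
    exact fun i _ => (hC'.eq_side hc' ▸ hy : y ∈ A.side Set.univ c') i trivial
  have hcont : Continuous (𝓕.hq q) := (𝓕.hq q).continuous_of_finiteDimensional
  have hle : 𝓕.hq q p ≤ 𝓕.hq q p' :=
    closure_minimal (fun y hy => hq_le_of_mem_side hgen hq hC hL hdim hpX hpF hpC hmin hc hy.2
      (hsub' y hy.1)) (isClosed_le continuous_const hcont) hpC'
  have hle' : 𝓕.hq q p' ≤ 𝓕.hq q p :=
    closure_minimal (fun y hy => hq_le_of_mem_side hgen hq hC' hL' hdim' hpX' hpF' hpC' hmin' hc'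
      hy.2 (hside' ▸ hsub y hy.1)) (isClosed_le continuous_const hcont) hpC
  have hpp : p = p' := by
    rcases Nat.eq_zero_or_pos q with rfl | hq0
    · obtain ⟨W, -, hW, hfr⟩ := exists_affineSubspace_eq_F hgen hq
      rw [← hW] at hpF hpF'
      have := AffineSubspace.vsub_mem_direction hpF hpF'
      rw [Submodule.finrank_eq_zero.1 hfr, Submodule.mem_bot] at this
      exact vsub_eq_zero_iff_eq.1 this
    · have hXX : X = X' := by
        by_contra hne
        exact h2 q hq0 hq X X' hL hL' hdim hdim' hne p ⟨hpX, hpF⟩ p' ⟨hpX', hpF'⟩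
          (le_antisymm hle hle')
      rw [← hXX, hXp] at hXp'
      exact Set.singleton_injective hXp'
  subst hpp
  obtain ⟨t, ht, ht'⟩ :=
    ((eventually_lineMap_mem_chamber hgen hq hC hL hdim hpX hpF hpC hc hside).and
      (eventually_lineMap_mem_chamber hgen hq hC' hL' hdim' hpX' hpF' hpC' hc'
        (hside' ▸ hside))).exists
  exact (hC.eq_side ht).trans (hC'.eq_side ht').symm

/-- `h_q` is constant on `Y ∩ F^q` only when `Y` has the smallest possible dimension. -/
theorem dimS_eq_of_hq_const (hgen : GenericFlag A 𝓕) (hq : q ≤ ℓ) {Y : Set (Fin ℓ → ℝ)}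
    (hY : A.L Y) {p : Fin ℓ → ℝ} (hpY : p ∈ Y) (hpF : p ∈ 𝓕.F q)
    (hconst : ∀ y ∈ Y, y ∈ 𝓕.F q → 𝓕.hq q y = 𝓕.hq q p) : dimS Y = ℓ - q := by
  have hge := le_add_dimS hgen hq hY hpY hpF
  have hle : dimS Y ≤ ℓ := by
    have h := (tau Y).finrank_le
    rwa [Module.finrank_fin_fun] at h
  by_contra hne
  obtain ⟨k, rfl⟩ : ∃ k, q = k + 1 := ⟨q - 1, by omega⟩
  have hF : 𝓕.F k = {y | y ∈ 𝓕.F (k + 1) ∧ 𝓕.hq (k + 1) y = 0} := by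
    have hk : 𝓕.hq (k + 1) = 𝓕.h ⟨k, hq⟩ := by
      simp [Flag.hq, Nat.lt_of_succ_le hq]
    ext y
    rw [Set.mem_ofPred_eq, hk]
    refine ⟨fun h => ⟨fun j hj => h j (by omega), h _ le_rfl⟩, fun h j hj => ?_⟩
    rcases hj.eq_or_lt with hj | hj
    · rw [← h.2]
      congr 2
      exact Fin.ext hj.symm
    · exact h.1 j hj
  obtain ⟨W, -, hW, hfr⟩ := (hgen Y hY (k + 1) hq).1 hge
  obtain ⟨W', ⟨w, hw⟩, hW', hfr'⟩ := (hgen Y hY k (by omega)).1 (by omega)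
  have hwY : w ∈ 𝓕.F k ∩ Y := hW' ▸ hw
  rw [hF] at hwY
  have hp0 : 𝓕.hq (k + 1) p = 0 := (hconst w hwY.2 hwY.1.1).symm.trans hwY.1.2
  have hWW : W = W' := by
    apply SetLike.coe_injective
    rw [hW, hW', hF]
    ext y
    exact ⟨fun h => ⟨⟨h.1, (hconst y h.2 h.1).trans hp0⟩, h.2⟩, fun h => ⟨h.1.1, h.2⟩⟩
  rw [hWW] at hfr
  omega

/-- Every chamber of the hyperplanes parallel to a transversal flat `X(I)` which misses `F^{q-1}`
contains a chamber `C ∈ ch^q_F` with `τ(X_C) = τ(X(I))`. -/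
theorem exists_chamber_tau_eq (hgen : GenericFlag A 𝓕) (hq : q ≤ ℓ) {t : Set (Fin n)}
    (hne : (⋂ i ∈ t, A.H i).Nonempty) (hdim : dimS (⋂ i ∈ t, A.H i) = ℓ - q)
    {XC : Set (Fin ℓ → ℝ) → Set (Fin ℓ → ℝ)}
    (hXC : ∀ C, ChF A 𝓕 q C → IsXC A 𝓕 q C (XC C)) {x : Fin ℓ → ℝ}
    (hx : x ∈ A.compOn (parIdx A (⋂ i ∈ t, A.H i)))
    (hF : q = 0 ∨ A.side (parIdx A (⋂ i ∈ t, A.H i)) x ∩ 𝓕.F (q - 1) = ∅) :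
    ∃ C, ChF A 𝓕 q C ∧ C ⊆ A.side (parIdx A (⋂ i ∈ t, A.H i)) x ∧
      tau (XC C) = tau (⋂ i ∈ t, A.H i) := by
  obtain ⟨g, hgF, hg⟩ := exists_mem_F_forall_ne_zero (𝓕 := 𝓕) hgen hq
  obtain ⟨y₀, hy₀F, hy₀⟩ := exists_mem_F_sub_mem_tau (𝓕 := 𝓕) hgen hq hne hdim x
  set P := parIdx A (⋂ i ∈ t, A.H i) with hP
  have hy₀D : y₀ ∈ A.side P x := by
    intro i hi
    have h : (A.α i).linear (x -ᵥ y₀) = 0 := hi hy₀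
    rw [AffineMap.linearMap_vsub, vsub_eq_sub, sub_eq_zero] at h
    rw [← h]
    exact mul_self_pos.2 (hx i hi)
  have hnear : ∀ y ∈ A.side P x, y ∈ 𝓕.F q → ∀ᶠ s : ℝ in 𝓝[>] 0,
      ∃ C, (ChF A 𝓕 q C ∧ C ⊆ A.side P x) ∧ AffineMap.lineMap y g s ∈ C ∩ 𝓕.F q := by
    intro y hy hyF
    have e1 : ∀ᶠ s : ℝ in 𝓝[>] 0, ∀ i, A.α i (AffineMap.lineMap y g s) ≠ 0 :=
      eventually_all.2 fun i => eventually_affine_lineMap_ne_zero _ _ _ (Or.inr (hg i))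
    have e2 : ∀ᶠ s : ℝ in 𝓝[>] 0, ∀ i : P, 0 < A.α i x * A.α i (AffineMap.lineMap y g s) :=
      eventually_all.2 fun i =>
        eventually_affine_lineMap_pos _ _ _ (Or.inl (hy i i.2))
    filter_upwards [e1, e2] with s hs1 hs2
    have hcomp : AffineMap.lineMap y g s ∈ A.compOn Set.univ := fun i _ => hs1 i
    have hD : A.side Set.univ (AffineMap.lineMap y g s) ⊆ A.side P x := fun z hz i hi =>
      mul_pos_trans (hs2 ⟨i, hi⟩) (hz i trivial)
    have hmem : AffineMap.lineMap y g s ∈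
        A.side Set.univ (AffineMap.lineMap y g s) ∩ 𝓕.F q :=
      ⟨mem_side_self hcomp, lineMap_mem_F hyF hgF s⟩
    refine ⟨_, ⟨⟨isChamberOn_side hcomp, ⟨_, hmem⟩, hF.imp_right fun h => ?_⟩, hD⟩, hmem⟩
    exact Set.subset_empty_iff.1 (h ▸ Set.inter_subset_inter_left _ hD)
  have hfin : {C | ChF A 𝓕 q C ∧ C ⊆ A.side P x}.Finite :=
    (finite_setOf_isChamber A).subset fun C hC => hC.1.1
  choose! m hm using fun C hC => (hXC C hC).2.2
  obtain ⟨C, ⟨hCh, hCD⟩, hCmin⟩ := Set.exists_min_image _ (fun C => 𝓕.hq q (m C)) hfin (by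
    obtain ⟨s, C, hC, -⟩ := (hnear y₀ hy₀D hy₀F).exists
    exact ⟨C, hC⟩)
  refine ⟨C, hCh, hCD, ?_⟩
  obtain ⟨hL, hdimX, -⟩ := hXC C hCh
  obtain ⟨hXp, hpC, -⟩ := hm C hCh
  set p := m C
  obtain ⟨hpX, hpF⟩ : p ∈ XC C ∩ 𝓕.F q := hXp ▸ rfl
  have hmin : ∀ y ∈ A.side P x, y ∈ 𝓕.F q → 𝓕.hq q p ≤ 𝓕.hq q y := by
    intro y hy hyF
    refine le_of_eventually_le_affine_lineMap _ y g ?_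
    filter_upwards [hnear y hy hyF] with s ⟨C', hC', hs⟩
    exact (hCmin C' hC').trans ((hm C' hC'.1).2.2 _ (subset_closure hs))
  have hpD : ∀ i ∈ P, 0 ≤ A.α i x * A.α i p := fun i hi =>
    mul_nonneg_of_mem_closure (closure_mono (Set.inter_subset_left.trans hCD) hpC) hi
  obtain ⟨c, hcC, hcF⟩ := hCh.2.1
  have hcD := hCD hcC
  set Y := ⋂ i ∈ {i | i ∈ P ∧ A.α i p = 0}, A.H i with hYdef
  have hmemY : ∀ {y}, y ∈ Y ↔ ∀ i ∈ P, A.α i p = 0 → A.α i y = 0 := by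
    intro y
    simp [hYdef, Arrangement.H]
  have hpY : p ∈ Y := hmemY.2 fun i _ h => h
  have hYle : ∀ y ∈ Y, y ∈ 𝓕.F q → 𝓕.hq q p ≤ 𝓕.hq q y := by
    intro y hy hyF
    refine affine_le_of_eventually_le_lineMap _ _ _ ?_
    have e : ∀ᶠ s : ℝ in 𝓝[>] 0, ∀ i : {i | i ∈ P ∧ A.α i p ≠ 0},
        0 < A.α i x * A.α i (AffineMap.lineMap p y s) :=
      eventually_all.2 fun i => eventually_affine_lineMap_pos _ _ _
        (Or.inl ((hpD i i.2.1).lt_of_ne' (mul_ne_zero (hx i i.2.1) i.2.2)))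
    filter_upwards [e] with s hs
    refine le_of_eventually_le_affine_lineMap _ _ c ?_
    have e' : ∀ᶠ r : ℝ in 𝓝[>] 0, ∀ i : P,
        0 < A.α i x * A.α i (AffineMap.lineMap (AffineMap.lineMap p y s) c r) := by
      refine eventually_all.2 fun i => eventually_affine_lineMap_pos _ _ _ ?_
      by_cases hi : A.α i p = 0
      · refine Or.inr ⟨?_, hcD i i.2⟩
        rw [affine_lineMap, hi, hmemY.1 hy i i.2 hi]
        ring
      · exact Or.inl (hs ⟨i, i.2, hi⟩)
    filter_upwards [e'] with r hr
    exact hmin _ (fun i hi => hr ⟨i, hi⟩) (lineMap_mem_F (lineMap_mem_F hpF hyF s) hcF r)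
  have hYdim : dimS Y = ℓ - q := by
    refine dimS_eq_of_hq_const hgen hq (L_iInter_s16 hpY) hpY hpF fun y hy hyF =>
      le_antisymm ?_ (hYle y hy hyF)
    have h := hYle (AffineMap.lineMap p y (-1 : ℝ))
      (hmemY.2 fun i hi h0 => by rw [affine_lineMap, h0, hmemY.1 hy i hi h0]; ring)
      (lineMap_mem_F hpF hyF _)
    rw [affine_lineMap] at h
    linarith
  have hTY : tau (⋂ i ∈ t, A.H i) = tau Y := by
    refine Submodule.eq_of_le_of_finrank_eq
      (fun v hv => (mem_tau_iInter hpY).2 fun i hi => hi.1 hv) (hdim.trans hYdim.symm)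
  have hXY : tau (XC C) = tau Y := by
    refine Submodule.eq_of_le_of_finrank_eq
      (fun v hv => (mem_tau_iInter hpY).2 fun i hi => ?_) (hdimX.trans hYdim.symm)
    exact tau_le_ker_of_apply_eq_zero hgen hq hL hdimX hpX hpF hi.2 hv
  rw [hXY, hTY]

end GenericFlags

section Closures

variable {ℓ n : ℕ} {A : Arrangement ℓ n}

theorem continuous_reP : Continuous (reP : (Fin ℓ → ℂ) → Fin ℓ → ℝ) :=
  continuous_pi fun j => Complex.continuous_re.comp (continuous_apply j)

theorem continuous_imP : Continuous (imP : (Fin ℓ → ℂ) → Fin ℓ → ℝ) :=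
  continuous_pi fun j => Complex.continuous_im.comp (continuous_apply j)

theorem ne_zero_of_mem_M {z : Fin ℓ → ℂ} (hz : z ∈ A.M) {T : Submodule ℝ (Fin ℓ → ℝ)}
    (him : imP z ∈ T) {i : Fin n} (hi : T ≤ LinearMap.ker (A.α i).linear) :
    A.α i (reP z) ≠ 0 :=
  fun h => hz i ⟨h, hi him⟩

/-- A set of points `x + iv` with `v ∈ T` and `x` in a chamber of hyperplanes parallel to `T` has
its closure in `M(A)` contained in the set of all such points. -/
theorem mem_of_mem_closure_of_subset {s : Set (Fin n)} {T : Submodule ℝ (Fin ℓ → ℝ)}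
    (hs : ∀ i ∈ s, T ≤ LinearMap.ker (A.α i).linear) {c : Fin ℓ → ℝ} (hc : c ∈ A.compOn s)
    {K : Set (Fin ℓ → ℂ)} (hK : ∀ z ∈ K, imP z ∈ T ∧ reP z ∈ A.side s c)
    {z : Fin ℓ → ℂ} (hzM : z ∈ A.M) (hz : z ∈ closure K) :
    imP z ∈ T ∧ reP z ∈ A.side s c := by
  have him : imP z ∈ T :=
    closure_minimal (fun w hw => (hK w hw).1)
      (T.closed_of_finiteDimensional.preimage continuous_imP) hz
  refine ⟨him, fun i hi => ?_⟩
  have hre : reP z ∈ closure (A.side s c) :=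
    map_mem_closure continuous_reP hz fun w hw => (hK w hw).2
  exact (mul_nonneg_of_mem_closure hre hi).lt_of_ne'
    (mul_ne_zero (hc i hi) (ne_zero_of_mem_M hzM him (hs i hi)))

theorem M_inter_closure_S (T : Submodule ℝ (Fin ℓ → ℝ)) {p : Fin ℓ → ℝ}
    (hp : ∀ i, A.α i p ≠ 0) :
    A.M ∩ closure (S A T p) =
      {z | z ∈ A.M ∧ imP z ∈ T ∧
        reP z ∈ A.side {i | T ≤ LinearMap.ker (A.α i).linear} p} := by
  classical
  ext z
  refine ⟨fun ⟨hzM, hz⟩ => ⟨hzM, mem_of_mem_closure_of_subset (fun i hi => hi)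
    (fun i _ => hp i) (fun w hw => ⟨hw.1, fun i hi => ?_⟩) hzM hz⟩,
    fun ⟨hzM, him, hre⟩ => ⟨hzM, ?_⟩⟩
  · by_contra h
    exact hw.2 i (sepPt_iff.2 (not_lt.1 h)) (hi hw.1)
  · obtain ⟨v, hvT, hv⟩ := exists_mem_forall_affine_ne_zero
      (Finset.univ.filter fun i => ¬ T ≤ LinearMap.ker (A.α i).linear)
      (fun i => (A.α i).linear.toAffineMap) T.toAffineSubspace ⟨0, T.zero_mem⟩ (by
        intro i hi
        obtain ⟨y, hy, hy0⟩ := SetLike.not_le_iff_exists.1 (Finset.mem_filter.1 hi).2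
        exact ⟨y, hy, hy0⟩)
    have hlim : Tendsto (fun s : ℝ => mkC (reP z) (AffineMap.lineMap (imP z) v s)) (𝓝[>] 0)
        (𝓝 z) := by
      have hcont : Continuous fun s : ℝ => mkC (reP z) (AffineMap.lineMap (imP z) v s) := by
        refine continuous_pi fun j => ?_
        have : (fun s : ℝ => mkC (reP z) (AffineMap.lineMap (imP z) v s) j) =
            fun s : ℝ => ((reP z j : ℝ) : ℂ) + ((imP z j + s * (v j - imP z j) : ℝ) : ℂ) *
              Complex.I := by
          ext s
          apply Complex.ext <;> simp [mkC, AffineMap.lineMap_apply]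
          ring
        rw [this]
        fun_prop
      have h0 : mkC (reP z) (AffineMap.lineMap (imP z) v (0 : ℝ)) = z := by
        rw [AffineMap.lineMap_apply_zero]
        rfl
      simpa only [h0] using (hcont.tendsto 0).mono_left nhdsWithin_le_nhds
    refine mem_closure_of_tendsto hlim ?_
    have e : ∀ᶠ s : ℝ in 𝓝[>] 0, ∀ i ∈ Finset.univ.filter
        fun i => ¬ T ≤ LinearMap.ker (A.α i).linear,
          (A.α i).linear.toAffineMap (AffineMap.lineMap (imP z) v s) ≠ 0 :=
      (Finset.eventually_all _).2 fun i hi =>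
        eventually_affine_lineMap_ne_zero _ _ _ (Or.inr (hv i hi))
    filter_upwards [e] with s hs
    refine ⟨AffineMap.lineMap_mem (Q := T.toAffineSubspace) s him hvT, fun i hi => hs i ?_⟩
    refine Finset.mem_filter.2 ⟨Finset.mem_univ i, fun hTi => ?_⟩
    exact (hre i hTi).not_ge (sepPt_iff.1 hi)

end Closures

/-- For independent `I` with distinguished chamber `C₀(I)` of
`A(I)` avoiding `F^{|I|-1}`, the closure in `M(A)` of
`S(I) = {x + iv : x ∈ C₀(I), v ∈ τ(X(I))}` is the disjoint union of the
closures in `M(A)` of the pieces `S(C)` over all `C ∈ ch^{|I|}_F(A)` with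
`C ⊆ C₀(I)` and `τ(X_C) = τ(X(I))`. -/
theorem closure_SI_decomposition (ℓ n : ℕ) (A : Arrangement ℓ n) (𝓕 : Flag ℓ)
    (hind : LinearIndependent ℝ fun j : Fin ℓ => (𝓕.h j).linear)
    (hgen : GenericFlag A 𝓕)
    (h1 : Cond1On A Set.univ 𝓕) (h2 : Cond2On A Set.univ 𝓕)
    (I : Finset (Fin n)) (hcard : I.card ≤ ℓ)
    (hne : (⋂ i ∈ I, A.H i).Nonempty)
    (hdim : dimS (⋂ i ∈ I, A.H i) = ℓ - I.card)
    (C₀ : Set (Fin ℓ → ℝ)) (hC₀ : A.IsChamberOn (I : Set (Fin n)) C₀)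
    (hC₀F : I.card = 0 ∨ C₀ ∩ 𝓕.F (I.card - 1) = ∅)
    (hC₀uniq : ∀ D : Set (Fin ℓ → ℝ), A.IsChamberOn (I : Set (Fin n)) D →
      (I.card = 0 ∨ D ∩ 𝓕.F (I.card - 1) = ∅) → D = C₀)
    (XC : Set (Fin ℓ → ℝ) → Set (Fin ℓ → ℝ))
    (pC : Set (Fin ℓ → ℝ) → (Fin ℓ → ℝ))
    (hdata : ∀ C, ChF A 𝓕 I.card C →
      IsXC A 𝓕 I.card C (XC C) ∧ pC C ∈ C ∩ 𝓕.F I.card) :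
    (A.M ∩ closure {z : Fin ℓ → ℂ | reP z ∈ C₀ ∧ imP z ∈ tau (⋂ i ∈ I, A.H i)} =
      ⋃ C ∈ {C : Set (Fin ℓ → ℝ) | ChF A 𝓕 I.card C ∧ C ⊆ C₀ ∧
          tau (XC C) = tau (⋂ i ∈ I, A.H i)},
        A.M ∩ closure (S A (tau (XC C)) (pC C))) ∧
    (∀ C C' : Set (Fin ℓ → ℝ),
      (ChF A 𝓕 I.card C ∧ C ⊆ C₀ ∧ tau (XC C) = tau (⋂ i ∈ I, A.H i)) →
      (ChF A 𝓕 I.card C' ∧ C' ⊆ C₀ ∧ tau (XC C') = tau (⋂ i ∈ I, A.H i)) →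
      C ≠ C' →
      (A.M ∩ closure (S A (tau (XC C)) (pC C))) ∩
        (A.M ∩ closure (S A (tau (XC C')) (pC C'))) = ∅) := by
  have hq := hcard
  have hbi : (⋂ i ∈ I, A.H i) = ⋂ i ∈ (I : Set (Fin n)), A.H i := by simp
  rw [hbi] at hne hdim ⊢
  set T := tau (⋂ i ∈ (I : Set (Fin n)), A.H i) with hT
  obtain ⟨p₀, hp₀⟩ := hne
  have hIpar : ∀ i ∈ (I : Set (Fin n)), T ≤ LinearMap.ker (A.α i).linear := fun i hi v hv =>
    (mem_tau_iInter hp₀).1 hv i hi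
  obtain ⟨x₀, hx₀, hC₀eq⟩ := hC₀
  rw [connectedComponentIn_compOn_s16 hx₀] at hC₀eq
  have hS : ∀ C, ChF A 𝓕 I.card C → tau (XC C) = T →
      A.M ∩ closure (S A (tau (XC C)) (pC C)) =
        {z | z ∈ A.M ∧ imP z ∈ T ∧
          reP z ∈ A.side {i | T ≤ LinearMap.ker (A.α i).linear} (pC C)} := by
    intro C hC hCT
    rw [hCT, M_inter_closure_S T fun i => hC.1.subset_compOn (hdata C hC).2.1 i trivial]
  constructor
  · ext z
    simp only [Set.mem_iUnion, Set.mem_ofPred_eq, exists_prop]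
    constructor
    · rintro ⟨hzM, hz⟩
      obtain ⟨him, hre⟩ := mem_of_mem_closure_of_subset hIpar hx₀
        (fun w hw => ⟨hw.2, hC₀eq ▸ hw.1⟩) hzM hz
      have hcomp : reP z ∈ A.compOn (parIdx A (⋂ i ∈ (I : Set (Fin n)), A.H i)) := fun i hi =>
        ne_zero_of_mem_M hzM him hi
      have hsub : A.side (parIdx A (⋂ i ∈ (I : Set (Fin n)), A.H i)) (reP z) ⊆ C₀ :=
        hC₀eq ▸ fun y hy i hi => mul_pos_trans (hre i hi) (hy i (hIpar i hi))
      have hmiss : I.card = 0 ∨ A.side (parIdx A (⋂ i ∈ (I : Set (Fin n)), A.H i)) (reP z) ∩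
          𝓕.F (I.card - 1) = ∅ := by
        refine hC₀F.imp_right fun h => ?_
        exact Set.subset_empty_iff.1 (h ▸ Set.inter_subset_inter_left _ hsub)
      obtain ⟨C, hC, hCD, hCT⟩ := exists_chamber_tau_eq hgen hq ⟨p₀, hp₀⟩ hdim
        (fun C hC => (hdata C hC).1) hcomp hmiss
      refine ⟨C, ⟨hC, hCD.trans hsub, hCT⟩, ?_⟩
      rw [hS C hC hCT]
      refine ⟨hzM, him, fun i hi => ?_⟩
      rw [mul_comm]
      exact hCD (hdata C hC).2.1 i hi
    · rintro ⟨C, ⟨hC, hCC₀, hCT⟩, hz⟩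
      rw [hS C hC hCT] at hz
      obtain ⟨hzM, him, hre⟩ := hz
      refine ⟨hzM, subset_closure ⟨?_, him⟩⟩
      have hpC := hCC₀ (hdata C hC).2.1
      rw [hC₀eq] at hpC ⊢
      exact fun i hi => mul_pos_trans (hpC i hi) (hre i (hIpar i hi))
  · rintro C C' ⟨hC, -, hCT⟩ ⟨hC', -, hCT'⟩ hne
    rw [hS C hC hCT, hS C' hC' hCT', Set.eq_empty_iff_forall_notMem]
    rintro z ⟨⟨-, -, hre⟩, -, -, hre'⟩
    refine hne (chamber_eq_of_same_side hgen h2 hq hC.1 hC'.1 (hdata C hC).1 (hdata C' hC').1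
      (hCT.trans hCT'.symm) (hdata C hC).2.1 (hdata C' hC').2.1 (hdata C hC).2.2
      (hdata C' hC').2.2 fun i hi => ?_)
    replace hi : T ≤ LinearMap.ker (A.α i).linear := hCT ▸ hi
    have := hre' i hi
    rw [mul_comm] at this
    exact mul_pos_trans (hre i hi) this

end IY
end
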